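/- Let n ≥ 1 and α > 0. Let f : ℝⁿ → ℝ be twice continuously differentiable with ν(x) = e^{-f(x)} a strictly positive probability density, and let ρ : ℝ × ℝⁿ → ℝ be such that ρ(t,·) is, for each t ≥ 0, a strictly positive probability density, twice continuously differentiable in x and continuously differentiable in t, satisfying ∂ρ/∂t (t,x) = div( ρ(t,x) ∇f(x) + ∇_x ρ(t,x) ) for all t ≥ 0 and x. Assume for every t ≥ 0: (i) the functions x ↦ ρ(t,x) log(ρ(t,x)/ν(x)) and x ↦ ρ(t,x) ‖∇_x log(ρ(t,x)/ν(x))‖² are integrable; (ii) H(t) = ∫ ρ(t,x) log(ρ(t,x)/ν(x)) dx is differentiable at t with H'(t) = ∫ ∂ρ/∂t (t,x) · log(ρ(t,x)/ν(x)) dx; (iii) ∫ div( log(ρ(t,x)/ν(x)) · ( ρ(t,x)∇f(x) + ∇_x ρ(t,x) ) ) dx = 0; and (iv) the log-Sobolev inequality in Fisher-information form holds: ∫ ρ(t,x) ‖∇_x log(ρ(t,x)/ν(x))‖² dx ≥ 2α · H(t). Then for all t ≥ 0, H(t) ≤ e^{-2αt} H(0). -/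

import Mathlib

open MeasureTheory Real

/-- Divergence of a vector field on `EuclideanSpace ℝ (Fin n)`:
`div V x = ∑ i, ∂V_i/∂x_i (x)`. -/
noncomputable def vdiv {n : ℕ} (V : EuclideanSpace ℝ (Fin n) → EuclideanSpace ℝ (Fin n))
    (x : EuclideanSpace ℝ (Fin n)) : ℝ :=
  ∑ i, fderiv ℝ (fun y => V y i) x (EuclideanSpace.single i 1)

namespace FPE
open Set Filter Topology

/-- partial derivative -/
noncomputable def pd {n : ℕ} (i : Fin n) (g : EuclideanSpace ℝ (Fin n) → ℝ)
    (x : EuclideanSpace ℝ (Fin n)) : ℝ :=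
  fderiv ℝ g x (EuclideanSpace.single i 1)

/-- the weighted Laplacian in divergence form, `div (ν ∇ v)` -/
noncomputable def Aop {n : ℕ} (ν v : EuclideanSpace ℝ (Fin n) → ℝ)
    (x : EuclideanSpace ℝ (Fin n)) : ℝ :=
  ∑ i, pd i (fun y => ν y * pd i v y) x

section pdcalc
variable {n : ℕ}

theorem pd_contDiff {g : EuclideanSpace ℝ (Fin n) → ℝ} (hg : ContDiff ℝ 2 g) (i : Fin n) :
    ContDiff ℝ 1 (pd i g) := by
  have h : ContDiff ℝ 1 (fderiv ℝ g) := hg.fderiv_right (by norm_num)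
  exact h.clm_apply contDiff_const

theorem pd_cont {g : EuclideanSpace ℝ (Fin n) → ℝ} (hg : ContDiff ℝ 1 g) (i : Fin n) :
    Continuous (pd i g) :=
  (hg.continuous_fderiv (by norm_num)).clm_apply continuous_const

theorem pd_compact {g : EuclideanSpace ℝ (Fin n) → ℝ} (hg : HasCompactSupport g) (i : Fin n) :
    HasCompactSupport (pd i g) := hg.fderiv_apply ℝ _

theorem pd_mul {g h : EuclideanSpace ℝ (Fin n) → ℝ} (hg : ContDiff ℝ 1 g) (hh : ContDiff ℝ 1 h)
    (i : Fin n) (x) : pd i (fun y => g y * h y) x = pd i g x * h x + g x * pd i h x := by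
  unfold pd
  rw [fderiv_fun_mul (hg.differentiable (by norm_num) x) (hh.differentiable (by norm_num) x)]
  simp; ring

theorem pd_sub {g h : EuclideanSpace ℝ (Fin n) → ℝ} (hg : ContDiff ℝ 1 g) (hh : ContDiff ℝ 1 h)
    (i : Fin n) (x) : pd i (fun y => g y - h y) x = pd i g x - pd i h x := by
  unfold pd
  rw [fderiv_fun_sub (hg.differentiable (by norm_num) x) (hh.differentiable (by norm_num) x)]
  simp

theorem pd_comp {g : EuclideanSpace ℝ (Fin n) → ℝ} (hg : ContDiff ℝ 1 g) {η : ℝ → ℝ} {η' : ℝ}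
    (i : Fin n) (x) (h : HasDerivAt η η' (g x)) : pd i (fun y => η (g y)) x = η' * pd i g x := by
  unfold pd
  have := (h.comp_hasFDerivAt x (hg.differentiable (by norm_num) x).hasFDerivAt).fderiv
  change fderiv ℝ (fun y => η (g y)) x = _ at this
  rw [this]; simp

theorem Aop_cont {ν v : EuclideanSpace ℝ (Fin n) → ℝ} (hν : ContDiff ℝ 1 ν) (hv : ContDiff ℝ 2 v) :
    Continuous (Aop ν v) := by
  unfold Aop
  exact continuous_finsetSum _ fun i _ => pd_cont (hν.mul (pd_contDiff hv i)) i

theorem Aop_sub {ν v w : EuclideanSpace ℝ (Fin n) → ℝ} (hν : ContDiff ℝ 1 ν) (hv : ContDiff ℝ 2 v)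
    (hw : ContDiff ℝ 2 w) (x) : Aop ν (fun y => v y - w y) x = Aop ν v x - Aop ν w x := by
  unfold Aop
  rw [← Finset.sum_sub_distrib]
  refine Finset.sum_congr rfl fun i _ => ?_
  rw [← pd_sub (hν.mul (pd_contDiff hv i)) (hν.mul (pd_contDiff hw i))]
  congr 1
  ext y
  rw [pd_sub (hv.of_le (by norm_num)) (hw.of_le (by norm_num))]; ring

theorem Aop_compact {ν v : EuclideanSpace ℝ (Fin n) → ℝ} (hv : HasCompactSupport v) :
    HasCompactSupport (Aop ν v) := by
  have : ∀ s : Finset (Fin n), HasCompactSupport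
      (fun x => ∑ i ∈ s, pd i (fun y => ν y * pd i v y) x) := by
    intro s
    induction s using Finset.cons_induction with
    | empty => simp only [Finset.sum_empty]; exact HasCompactSupport.zero
    | cons a s ha ih =>
      simp only [Finset.sum_cons]
      exact (pd_compact ((pd_compact hv a).mul_left) a).add ih
  exact this _

theorem ibp {g V : EuclideanSpace ℝ (Fin n) → ℝ} (hg : ContDiff ℝ 1 g) (hV : ContDiff ℝ 1 V)
    (hc : HasCompactSupport g ∨ HasCompactSupport V) (i : Fin n) :
    ∫ x, g x * pd i V x = - ∫ x, pd i g x * V x := by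
  have key : ∀ (a b : EuclideanSpace ℝ (Fin n) → ℝ), Continuous a → Continuous b →
      (HasCompactSupport a ∨ HasCompactSupport b) → Integrable (fun x => a x * b x) := by
    intro a b ha hb h
    refine (ha.mul hb).integrable_of_hasCompactSupport ?_
    rcases h with h | h
    · exact h.mul_right
    · exact h.mul_left
  refine integral_mul_fderiv_eq_neg_fderiv_mul_of_integrable ?_ ?_ ?_
    (fun x _ => hg.differentiable (by norm_num) x) (fun x _ => hV.differentiable (by norm_num) x)
  · exact key _ _ (pd_cont hg i) hV.continuous (hc.imp (fun h => pd_compact h i) id)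
  · exact key _ _ hg.continuous (pd_cont hV i) (hc.imp id (fun h => pd_compact h i))
  · exact key _ _ hg.continuous hV.continuous hc

theorem ibpA {ν g v : EuclideanSpace ℝ (Fin n) → ℝ} (hν : ContDiff ℝ 1 ν) (hg : ContDiff ℝ 1 g)
    (hv : ContDiff ℝ 2 v) (hc : HasCompactSupport g ∨ HasCompactSupport v) :
    ∫ x, g x * Aop ν v x = - ∫ x, ν x * ∑ i, pd i g x * pd i v x := by
  have hc' : ∀ i, HasCompactSupport g ∨ HasCompactSupport (fun y => ν y * pd i v y) :=
    fun i => hc.imp id (fun h => (pd_compact h i).mul_left)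
  have hV : ∀ i, ContDiff ℝ 1 (fun y => ν y * pd i v y) := fun i => hν.mul (pd_contDiff hv i)
  have e1 : ∀ x, g x * Aop ν v x = ∑ i, g x * pd i (fun y => ν y * pd i v y) x := by
    intro x; unfold Aop; rw [Finset.mul_sum]
  have e2 : ∀ x, ν x * ∑ i, pd i g x * pd i v x = ∑ i, pd i g x * (ν x * pd i v x) := by
    intro x; rw [Finset.mul_sum]; exact Finset.sum_congr rfl fun i _ => by ring
  simp_rw [e1, e2]
  rw [integral_finsetSum, integral_finsetSum, ← Finset.sum_neg_distrib]
  · exact Finset.sum_congr rfl fun i _ => ibp hg (hV i) (hc' i) i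
  · intro i _
    refine ((pd_cont hg i).mul (hV i).continuous).integrable_of_hasCompactSupport ?_
    rcases hc' i with h | h
    · exact (pd_compact h i).mul_right
    · exact h.mul_left
  · intro i _
    refine (hg.continuous.mul (pd_cont (hV i) i)).integrable_of_hasCompactSupport ?_
    rcases hc' i with h | h
    · exact h.mul_right
    · exact (pd_compact h i).mul_left

end pdcalc

/-- admissible convex nonlinearities -/
structure Adm (Ω : Set ℝ) (η η1 η2 : ℝ → ℝ) (B : ℝ) : Prop where
  opn : IsOpen Ω
  cvx : Convex ℝ Ω
  d1 : ∀ v ∈ Ω, HasDerivAt η (η1 v) v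
  d2 : ∀ v ∈ Ω, HasDerivAt η1 (η2 v) v
  c2 : ContinuousOn η2 Ω
  pos : ∀ v ∈ Ω, 0 ≤ η2 v
  bd : ∀ v ∈ Ω, |η1 v| ≤ B

/-- solutions (in terms of the relative density `u`) -/
structure Sys (n : ℕ) where
  ν : EuclideanSpace ℝ (Fin n) → ℝ
  u : ℝ → EuclideanSpace ℝ (Fin n) → ℝ
  ud : ℝ → EuclideanSpace ℝ (Fin n) → ℝ
  νC : ContDiff ℝ 1 ν
  νpos : ∀ x, 0 < ν x
  νint : Integrable ν
  νmass : ∫ x, ν x = 1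
  uC : ∀ t, 0 ≤ t → ContDiff ℝ 2 (u t)
  upos : ∀ t, 0 ≤ t → ∀ x, 0 < u t x
  uint : ∀ t, 0 ≤ t → Integrable (fun x => u t x * ν x)
  umass : ∀ t, 0 ≤ t → ∫ x, u t x * ν x = 1
  hud : ∀ x t, HasDerivAt (fun s => u s x) (ud t x) t
  udc : ∀ x, Continuous (fun t => ud t x)
  pde : ∀ t, 0 ≤ t → ∀ x, ud t x * ν x = Aop ν (u t) x

namespace Adm
variable {Ω : Set ℝ} {η η1 η2 : ℝ → ℝ} {B : ℝ}

theorem C1 (h : Adm Ω η η1 η2 B) : ContDiffOn ℝ 1 η1 Ω := by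
  rw [show (1 : WithTop ℕ∞) = 0 + 1 from rfl, contDiffOn_succ_iff_deriv_of_isOpen h.opn]
  refine ⟨fun v hv => (h.d2 v hv).differentiableAt.differentiableWithinAt, by simp, ?_⟩
  rw [contDiffOn_zero]
  exact h.c2.congr fun v hv => (h.d2 v hv).deriv

theorem C1' (h : Adm Ω η η1 η2 B) : ContDiffOn ℝ 1 η Ω := by
  rw [show (1 : WithTop ℕ∞) = 0 + 1 from rfl, contDiffOn_succ_iff_deriv_of_isOpen h.opn]
  refine ⟨fun v hv => (h.d1 v hv).differentiableAt.differentiableWithinAt, by simp, ?_⟩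
  rw [contDiffOn_zero]
  exact h.C1.continuousOn.congr fun v hv => (h.d1 v hv).deriv

theorem lip (h : Adm Ω η η1 η2 B) {v w : ℝ} (hv : v ∈ Ω) (hw : w ∈ Ω) :
    |η v - η w| ≤ B * |v - w| := by
  have := h.cvx.norm_image_sub_le_of_norm_hasDerivWithin_le
    (fun x hx => (h.d1 x hx).hasDerivWithinAt) (fun x hx => h.bd x hx) hw hv
  simpa using this

theorem growth (h : Adm Ω η η1 η2 B) : ∃ c, 0 ≤ c ∧ ∀ v ∈ Ω, |η v| ≤ c * (1 + |v|) := by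
  rcases Ω.eq_empty_or_nonempty with rfl | ⟨w, hw⟩
  · exact ⟨0, le_rfl, by simp⟩
  have hB : 0 ≤ B := (abs_nonneg _).trans (h.bd w hw)
  refine ⟨|η w| + B * |w| + B, by positivity, fun v hv => ?_⟩
  have h1 := h.lip hv hw
  have h2 : |η v| ≤ |η v - η w| + |η w| := by
    have := abs_add_le (η v - η w) (η w); simpa using this
  have h3 : |v - w| ≤ |v| + |w| := abs_sub v w
  have h4 : B * |v - w| ≤ B * (|v| + |w|) := mul_le_mul_of_nonneg_left h3 hB
  have := mul_nonneg (abs_nonneg (η w)) (abs_nonneg v)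
  have := mul_nonneg (mul_nonneg hB (abs_nonneg w)) (abs_nonneg v)
  nlinarith

end Adm
end FPE

namespace FPE
open Set Filter Topology

/-- admissible comparison functions -/
structure RA {n : ℕ} (S : Sys n) (Ω : Set ℝ) (r : EuclideanSpace ℝ (Fin n) → ℝ) : Prop where
  C : ContDiff ℝ 2 r
  int : Integrable (fun x => r x * S.ν x)
  mem : ∀ t, 0 ≤ t → ∀ x, S.u t x - r x ∈ Ω

/-- cutoff functions -/
structure Cut {n : ℕ} (ψ : EuclideanSpace ℝ (Fin n) → ℝ) : Prop where
  C : ContDiff ℝ 2 ψ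
  c : HasCompactSupport ψ
  pos : ∀ x, 0 ≤ ψ x

section
variable {n : ℕ} (S : Sys n) (ψ r : EuclideanSpace ℝ (Fin n) → ℝ)

noncomputable def Fun (η : ℝ → ℝ) (t : ℝ) : ℝ :=
  ∫ x, ψ x * S.ν x * η (S.u t x - r x)

noncomputable def Dis (η1 : ℝ → ℝ) (t : ℝ) : ℝ :=
  ∫ x, ψ x * S.ν x * (η1 (S.u t x - r x) * S.ud t x)

noncomputable def Wis (η2 : ℝ → ℝ) (t : ℝ) : ℝ :=
  ∫ x, S.ν x * (ψ x * η2 (S.u t x - r x) * ∑ i, pd i (fun y => S.u t y - r y) x ^ 2)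

variable {S ψ r} {Ω : Set ℝ} {η η1 η2 : ℝ → ℝ} {B : ℝ}

theorem comp_cd (hη : ContDiffOn ℝ 1 η Ω) (hr : RA S Ω r) (ho : IsOpen Ω) {t : ℝ} (ht : 0 ≤ t) :
    ContDiff ℝ 1 (fun x => η (S.u t x - r x)) := by
  rw [contDiff_iff_contDiffAt]
  intro x
  exact ContDiffAt.comp (g := η) (f := fun x => S.u t x - r x) x
    ((hη _ (hr.mem t ht x)).contDiffAt (ho.mem_nhds (hr.mem t ht x)))
    (((S.uC t ht).sub hr.C).of_le (by norm_num)).contDiffAt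

theorem v_cd (hr : RA S Ω r) {t : ℝ} (ht : 0 ≤ t) : ContDiff ℝ 2 (fun x => S.u t x - r x) :=
  (S.uC t ht).sub hr.C

theorem W_int (hψ : Cut ψ) (hη : Adm Ω η η1 η2 B) (hr : RA S Ω r) {t : ℝ} (ht : 0 ≤ t) :
    Integrable (fun x => S.ν x * (ψ x * η2 (S.u t x - r x) *
      ∑ i, pd i (fun y => S.u t y - r y) x ^ 2)) := by
  have h2 : Continuous (fun x => η2 (S.u t x - r x)) :=
    hη.c2.comp_continuous (v_cd hr ht).continuous (hr.mem t ht)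
  refine Continuous.integrable_of_hasCompactSupport ?_ ?_
  · refine S.νC.continuous.mul ((hψ.C.continuous.mul h2).mul ?_)
    exact continuous_finsetSum _ fun i _ =>
      (pd_cont ((v_cd hr ht).of_le (by norm_num)) i).pow 2
  · exact ((hψ.c.mul_right).mul_right).mul_left

/-- first form of the dissipation -/
theorem D_eq1 (hψ : Cut ψ) (hη : Adm Ω η η1 η2 B) (hr : RA S Ω r) {t : ℝ} (ht : 0 ≤ t) :
    Dis S ψ r η1 t = - Wis S ψ r η2 t
      - (∫ x, S.ν x * (η1 (S.u t x - r x) * ∑ i, pd i ψ x * pd i (fun y => S.u t y - r y) x))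
      + ∫ x, ψ x * η1 (S.u t x - r x) * Aop S.ν r x := by
  have hv := v_cd hr ht
  have hv1 : ContDiff ℝ 1 (fun x => S.u t x - r x) := hv.of_le (by norm_num)
  have hg1 := comp_cd hη.C1 hr hη.opn ht
  have hψ1 : ContDiff ℝ 1 ψ := hψ.C.of_le (by norm_num)
  have hg : ContDiff ℝ 1 (fun x => ψ x * η1 (S.u t x - r x)) := hψ1.mul hg1
  have hgc : HasCompactSupport (fun x => ψ x * η1 (S.u t x - r x)) := hψ.c.mul_right
  have e1 : Dis S ψ r η1 t = ∫ x, ((ψ x * η1 (S.u t x - r x)) * Aop S.ν (fun y => S.u t y - r y) x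
      + ψ x * η1 (S.u t x - r x) * Aop S.ν r x) := by
    unfold Dis
    refine integral_congr_ae (Eventually.of_forall fun x => ?_)
    simp only
    rw [Aop_sub S.νC (S.uC t ht) hr.C, ← S.pde t ht]; ring
  rw [e1, integral_add, ibpA S.νC hg hv (Or.inl hgc)]
  · congr 1
    rw [← neg_add', Wis, ← integral_add (W_int hψ hη hr ht)]
    · congr 1
      refine integral_congr_ae (Eventually.of_forall fun x => ?_)
      simp only
      rw [← mul_add]
      congr 1
      rw [Finset.mul_sum, Finset.mul_sum, ← Finset.sum_add_distrib]
      refine Finset.sum_congr rfl fun i _ => ?_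
      rw [pd_mul hψ1 hg1, pd_comp hv1 i x (hη.d2 _ (hr.mem t ht x))]
      ring
    · refine Continuous.integrable_of_hasCompactSupport ?_ ?_
      · refine S.νC.continuous.mul (hg1.continuous.mul ?_)
        exact continuous_finsetSum _ fun i _ => (pd_cont hψ1 i).mul (pd_cont hv1 i)
      · refine HasCompactSupport.mul_left (HasCompactSupport.mul_left ?_)
        have : ∀ s : Finset (Fin n), HasCompactSupport
            (fun x => ∑ i ∈ s, pd i ψ x * pd i (fun y => S.u t y - r y) x) := by
          intro s
          induction s using Finset.cons_induction with
          | empty => simp only [Finset.sum_empty]; exact HasCompactSupport.zero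
          | cons a s ha ih =>
            simp only [Finset.sum_cons]
            exact (pd_compact hψ.c a).mul_right.add ih
        exact this _
  · exact (hg.continuous.mul (Aop_cont S.νC hv)).integrable_of_hasCompactSupport hgc.mul_right
  · exact (hg.continuous.mul (Aop_cont S.νC hr.C)).integrable_of_hasCompactSupport hgc.mul_right

/-- second form of the dissipation -/
theorem D_eq2 (hψ : Cut ψ) (hη : Adm Ω η η1 η2 B) (hr : RA S Ω r) {t : ℝ} (ht : 0 ≤ t) :
    Dis S ψ r η1 t = - Wis S ψ r η2 t
      + (∫ x, η (S.u t x - r x) * Aop S.ν ψ x)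
      + ∫ x, ψ x * η1 (S.u t x - r x) * Aop S.ν r x := by
  rw [D_eq1 hψ hη hr ht, ibpA S.νC (comp_cd hη.C1' hr hη.opn ht) hψ.C (Or.inr hψ.c)]
  congr 1
  rw [sub_eq_add_neg]
  congr 2
  refine integral_congr_ae (Eventually.of_forall fun x => ?_)
  simp only
  congr 1
  rw [Finset.mul_sum]
  refine Finset.sum_congr rfl fun i _ => ?_
  rw [pd_comp ((v_cd hr ht).of_le (by norm_num)) i x (hη.d1 _ (hr.mem t ht x))]
  ring

theorem W_nonneg (hψ : Cut ψ) (hη : Adm Ω η η1 η2 B) (hr : RA S Ω r) {t : ℝ} (ht : 0 ≤ t) :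
    0 ≤ Wis S ψ r η2 t :=
  integral_nonneg fun x => mul_nonneg (S.νpos x).le (mul_nonneg (mul_nonneg (hψ.pos x)
    (hη.pos _ (hr.mem t ht x))) (Finset.sum_nonneg fun i _ => sq_nonneg _))

theorem cpsi (S : Sys n) (hψ : Cut ψ) : ∃ c, 0 ≤ c ∧ ∀ x, |Aop S.ν ψ x| ≤ c * S.ν x := by
  have h1 : Continuous (fun x => Aop S.ν ψ x / S.ν x) :=
    (Aop_cont S.νC hψ.C).div S.νC.continuous fun x => (S.νpos x).ne'
  have h2 : HasCompactSupport (fun x => Aop S.ν ψ x / S.ν x) := by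
    simp only [div_eq_mul_inv]; exact (Aop_compact hψ.c).mul_right
  obtain ⟨c, hc⟩ := h2.exists_bound_of_continuous h1
  refine ⟨c, (norm_nonneg _).trans (hc 0), fun x => ?_⟩
  have := hc x
  rw [norm_div, div_le_iff₀ (by simpa using (S.νpos x).ne'), Real.norm_of_nonneg (S.νpos x).le] at this
  exact this

theorem v_int (hr : RA S Ω r) {t : ℝ} (ht : 0 ≤ t) :
    Integrable (fun x => |S.u t x - r x| * S.ν x) := by
  have := ((S.uint t ht).sub hr.int).abs
  refine this.congr (Eventually.of_forall fun x => ?_)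
  simp only [Pi.sub_apply]
  rw [← sub_mul, abs_mul, abs_of_pos (S.νpos x)]

theorem v_int_le (hr : RA S Ω r) {t : ℝ} (ht : 0 ≤ t) :
    ∫ x, |S.u t x - r x| * S.ν x ≤ 1 + ∫ x, |r x| * S.ν x := by
  have hri : Integrable (fun x => |r x| * S.ν x) := by
    refine hr.int.abs.congr (Eventually.of_forall fun x => ?_)
    simp only; rw [abs_mul, abs_of_pos (S.νpos x)]
  rw [← S.umass t ht, ← integral_add (S.uint t ht) hri]
  refine integral_mono (v_int hr ht) ((S.uint t ht).add hri) fun x => ?_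
  simp only
  rw [← add_mul]
  refine mul_le_mul_of_nonneg_right ?_ (S.νpos x).le
  have := abs_sub (S.u t x) (r x)
  rwa [abs_of_pos (S.upos t ht x)] at this

theorem eta_int (hη : Adm Ω η η1 η2 B) (hr : RA S Ω r) {t : ℝ} (ht : 0 ≤ t) :
    Integrable (fun x => |η (S.u t x - r x)| * S.ν x) := by
  obtain ⟨c, hc0, hc⟩ := hη.growth
  refine Integrable.mono' ((S.νint.add (v_int hr ht)).const_mul c) ?_
    (Eventually.of_forall fun x => ?_)
  · exact ((comp_cd hη.C1' hr hη.opn ht).continuous.abs.mul S.νC.continuous).aestronglyMeasurable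
  · simp only [Pi.add_apply]
    rw [Real.norm_of_nonneg (mul_nonneg (abs_nonneg _) (S.νpos x).le)]
    have := mul_le_mul_of_nonneg_right (hc _ (hr.mem t ht x)) (S.νpos x).le
    linarith

theorem D_le (hψ : Cut ψ) (hη : Adm Ω η η1 η2 B) (hr : RA S Ω r) {c : ℝ} 
    (hc : ∀ x, |Aop S.ν ψ x| ≤ c * S.ν x) {t : ℝ} (ht : 0 ≤ t) :
    Dis S ψ r η1 t ≤ c * (∫ x, |η (S.u t x - r x)| * S.ν x) + B * ∫ x, ψ x * |Aop S.ν r x| := by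
  rw [D_eq2 hψ hη hr ht]
  have hW := W_nonneg hψ hη hr ht
  have h1 : (∫ x, η (S.u t x - r x) * Aop S.ν ψ x) ≤ c * (∫ x, |η (S.u t x - r x)| * S.ν x) := by
    rw [← integral_const_mul]
    refine integral_mono ?_ ((eta_int hη hr ht).const_mul c) fun x => ?_
    · exact ((comp_cd hη.C1' hr hη.opn ht).continuous.mul
        (Aop_cont S.νC hψ.C)).integrable_of_hasCompactSupport (Aop_compact hψ.c).mul_left
    · simp only
      calc η (S.u t x - r x) * Aop S.ν ψ x ≤ |η (S.u t x - r x)| * |Aop S.ν ψ x| := by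
            rw [← abs_mul]; exact le_abs_self _
        _ ≤ |η (S.u t x - r x)| * (c * S.ν x) := mul_le_mul_of_nonneg_left (hc x) (abs_nonneg _)
        _ = _ := by ring
  have h2 : (∫ x, ψ x * η1 (S.u t x - r x) * Aop S.ν r x) ≤ B * ∫ x, ψ x * |Aop S.ν r x| := by
    rw [← integral_const_mul]
    refine integral_mono ?_ ?_ fun x => ?_
    · exact ((hψ.C.continuous.mul (comp_cd hη.C1 hr hη.opn ht).continuous).mul
        (Aop_cont S.νC hr.C)).integrable_of_hasCompactSupport hψ.c.mul_right.mul_right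
    · exact ((hψ.C.continuous.mul (Aop_cont S.νC hr.C).abs).integrable_of_hasCompactSupport
        hψ.c.mul_right).const_mul B
    · simp only
      have h3 := hη.bd _ (hr.mem t ht x)
      calc ψ x * η1 (S.u t x - r x) * Aop S.ν r x
          ≤ |ψ x * η1 (S.u t x - r x) * Aop S.ν r x| := le_abs_self _
        _ = |η1 (S.u t x - r x)| * (ψ x * |Aop S.ν r x|) := by
            rw [abs_mul, abs_mul, abs_of_nonneg (hψ.pos x)]; ring
        _ ≤ _ := mul_le_mul_of_nonneg_right h3 (mul_nonneg (hψ.pos x) (abs_nonneg _))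
  linarith

theorem D_le_const (hψ : Cut ψ) (hη : Adm Ω η η1 η2 B) (hr : RA S Ω r) :
    ∃ M, ∀ t, 0 ≤ t → Dis S ψ r η1 t ≤ M := by
  obtain ⟨c, hc0, hc⟩ := cpsi S hψ
  obtain ⟨b, hb0, hb⟩ := hη.growth
  refine ⟨c * (b * (1 + (1 + ∫ x, |r x| * S.ν x))) + B * ∫ x, ψ x * |Aop S.ν r x|,
    fun t ht => (D_le hψ hη hr hc ht).trans ?_⟩
  gcongr
  calc ∫ x, |η (S.u t x - r x)| * S.ν x ≤ ∫ x, b * (S.ν x + |S.u t x - r x| * S.ν x) := by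
        refine integral_mono (eta_int hη hr ht) ((S.νint.add (v_int hr ht)).const_mul b) fun x => ?_
        have := mul_le_mul_of_nonneg_right (hb _ (hr.mem t ht x)) (S.νpos x).le
        simp only; linarith
    _ = b * (1 + ∫ x, |S.u t x - r x| * S.ν x) := by
        rw [integral_const_mul, integral_add S.νint (v_int hr ht), S.νmass]
    _ ≤ _ := by gcongr; exact v_int_le hr ht

/-- Scheffé: continuity in `L¹` -/
theorem scheffe (S : Sys n) {t : ℝ} (ht : 0 ≤ t) :
    Tendsto (fun s => ∫ x, |S.u s x - S.u t x| * S.ν x) (𝓝[Ici 0] t) (𝓝 0) := by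
  have key : Tendsto (fun s => ∫ x, max (S.u t x - S.u s x) 0 * S.ν x) (𝓝[Ici 0] t)
      (𝓝 (∫ x, max (S.u t x - S.u t x) 0 * S.ν x)) := by
    refine tendsto_integral_filter_of_dominated_convergence (fun x => S.u t x * S.ν x) ?_ ?_
      (S.uint t ht) ?_
    · filter_upwards [self_mem_nhdsWithin] with s hs
      exact ((((S.uC t ht).continuous.sub (S.uC s hs).continuous).max continuous_const).mul
        S.νC.continuous).aestronglyMeasurable
    · filter_upwards [self_mem_nhdsWithin] with s hs
      refine Eventually.of_forall fun x => ?_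
      rw [Real.norm_of_nonneg (mul_nonneg (le_max_right _ _) (S.νpos x).le)]
      refine mul_le_mul_of_nonneg_right (max_le ?_ (S.upos t ht x).le) (S.νpos x).le
      linarith [S.upos s hs x]
    · refine Eventually.of_forall fun x => ?_
      have h1 : Tendsto (fun s => S.u s x) (𝓝[Ici 0] t) (𝓝 (S.u t x)) :=
        (S.hud x t).continuousAt.tendsto.mono_left nhdsWithin_le_nhds
      exact ((tendsto_const_nhds.sub h1).max tendsto_const_nhds).mul_const _
  simp only [sub_self, max_self, zero_mul, integral_zero] at key
  have := key.const_mul 2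
  rw [mul_zero] at this
  refine this.congr' ?_
  filter_upwards [self_mem_nhdsWithin] with s hs
  have hi : Integrable (fun x => max (S.u t x - S.u s x) 0 * S.ν x) := by
    refine Integrable.mono' (S.uint t ht) ((((S.uC t ht).continuous.sub
      (S.uC s hs).continuous).max continuous_const).mul S.νC.continuous).aestronglyMeasurable ?_
    refine Eventually.of_forall fun x => ?_
    rw [Real.norm_of_nonneg (mul_nonneg (le_max_right _ _) (S.νpos x).le)]
    refine mul_le_mul_of_nonneg_right (max_le ?_ (S.upos t ht x).le) (S.νpos x).le
    linarith [S.upos s hs x]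
  have h0 : ∫ x, (S.u s x * S.ν x - S.u t x * S.ν x) = 0 := by
    rw [integral_sub (S.uint s hs) (S.uint t ht), S.umass s hs, S.umass t ht, sub_self]
  have h1 := integral_add (hi.const_mul 2) ((S.uint s hs).sub (S.uint t ht))
  simp only [Pi.sub_apply] at h1
  rw [h0, add_zero, integral_const_mul] at h1
  rw [← h1]
  refine integral_congr_ae (Eventually.of_forall fun x => ?_)
  simp only
  rcases le_total (S.u s x) (S.u t x) with h | h
  · rw [max_eq_left (by linarith), abs_of_nonpos (by linarith)]; ring
  · rw [max_eq_right (by linarith), abs_of_nonneg (by linarith)]; ring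

theorem uu_int (S : Sys n) {s t : ℝ} (hs : 0 ≤ s) (ht : 0 ≤ t) :
    Integrable (fun x => |S.u s x - S.u t x| * S.ν x) := by
  have := ((S.uint s hs).sub (S.uint t ht)).abs
  refine this.congr (Eventually.of_forall fun x => ?_)
  simp only [Pi.sub_apply]
  rw [← sub_mul, abs_mul, abs_of_pos (S.νpos x)]

theorem psi_bd (hψ : Cut ψ) : ∃ c, 0 ≤ c ∧ ∀ x, ψ x ≤ c := by
  obtain ⟨c, hc⟩ := hψ.c.exists_bound_of_continuous hψ.C.continuous
  exact ⟨c, (norm_nonneg _).trans (hc 0), fun x => (le_abs_self _).trans (hc x)⟩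

theorem psi_uu_int (hψ : Cut ψ) (S : Sys n) {s t : ℝ} (hs : 0 ≤ s) (ht : 0 ≤ t) :
    Integrable (fun x => ψ x * S.ν x * |S.u s x - S.u t x|) := 
  ((hψ.C.continuous.mul S.νC.continuous).mul ((S.uC s hs).continuous.sub
    (S.uC t ht).continuous).abs).integrable_of_hasCompactSupport hψ.c.mul_right.mul_right

theorem F_int (hψ : Cut ψ) (hη : Adm Ω η η1 η2 B) (hr : RA S Ω r) {t : ℝ} (ht : 0 ≤ t) :
    Integrable (fun x => ψ x * S.ν x * η (S.u t x - r x)) :=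
  ((hψ.C.continuous.mul S.νC.continuous).mul
    (comp_cd hη.C1' hr hη.opn ht).continuous).integrable_of_hasCompactSupport hψ.c.mul_right.mul_right

theorem F_lip (hψ : Cut ψ) (hη : Adm Ω η η1 η2 B) (hr : RA S Ω r) {s t : ℝ} (hs : 0 ≤ s)
    (ht : 0 ≤ t) : ∫ x, |ψ x * S.ν x * η (S.u s x - r x) - ψ x * S.ν x * η (S.u t x - r x)|
      ≤ B * ∫ x, ψ x * S.ν x * |S.u s x - S.u t x| := by
  rw [← integral_const_mul]
  refine integral_mono ((F_int hψ hη hr hs).sub (F_int hψ hη hr ht)).abs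
    ((psi_uu_int hψ S hs ht).const_mul B) fun x => ?_
  simp only
  have h0 : 0 ≤ ψ x * S.ν x := mul_nonneg (hψ.pos x) (S.νpos x).le
  have h1 := hη.lip (hr.mem s hs x) (hr.mem t ht x)
  rw [sub_sub_sub_cancel_right] at h1
  rw [← mul_sub, abs_mul, abs_of_nonneg h0]
  calc _ ≤ ψ x * S.ν x * (B * |S.u s x - S.u t x|) := mul_le_mul_of_nonneg_left h1 h0
    _ = _ := by ring

theorem F_lip' (hψ : Cut ψ) (hη : Adm Ω η η1 η2 B) (hr : RA S Ω r) {s t : ℝ} (hs : 0 ≤ s)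
    (ht : 0 ≤ t) : |Fun S ψ r η s - Fun S ψ r η t| ≤ B * ∫ x, ψ x * S.ν x * |S.u s x - S.u t x| := by
  refine le_trans ?_ (F_lip hψ hη hr hs ht)
  unfold Fun
  rw [← integral_sub (F_int hψ hη hr hs) (F_int hψ hη hr ht)]
  exact abs_integral_le_integral_abs

theorem F_cont (hψ : Cut ψ) (hη : Adm Ω η η1 η2 B) (hr : RA S Ω r) :
    ContinuousOn (Fun S ψ r η) (Ici 0) := by
  intro t ht
  have hB : 0 ≤ B := (abs_nonneg _).trans (hη.bd _ (hr.mem t ht 0))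
  obtain ⟨c, hc0, hc⟩ := psi_bd hψ
  rw [ContinuousWithinAt, tendsto_iff_dist_tendsto_zero]
  have h := (scheffe S ht).const_mul (B * c)
  rw [mul_zero] at h
  refine squeeze_zero' (Eventually.of_forall fun _ => dist_nonneg) ?_ h
  filter_upwards [self_mem_nhdsWithin] with s hs
  rw [Real.dist_eq]
  refine (F_lip' hψ hη hr hs ht).trans ?_
  rw [mul_assoc]
  refine mul_le_mul_of_nonneg_left ?_ hB
  rw [← integral_const_mul]
  refine integral_mono (psi_uu_int hψ S hs ht) ((uu_int S hs ht).const_mul c) fun x => ?_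
  simp only
  have := mul_le_mul_of_nonneg_right (hc x) (mul_nonneg (S.νpos x).le (abs_nonneg (S.u s x - S.u t x)))
  linarith

/-- joint measurability (after stopping time at `0`) -/
theorem u_meas (S : Sys n) :
    Measurable (fun p : ℝ × EuclideanSpace ℝ (Fin n) => S.u (max p.1 0) p.2) := by
  refine measurable_uncurry_of_continuous_of_measurable
    (u := fun (t : ℝ) x => S.u (max t 0) x) (fun x => ?_) fun t => ?_
  · have : Continuous (fun t => S.u t x) :=
      continuous_iff_continuousAt.2 fun t => (S.hud x t).continuousAt
    exact this.comp (continuous_id.max continuous_const)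
  · exact (S.uC _ (le_max_right _ _)).continuous.measurable

theorem ud_cont (S : Sys n) {t : ℝ} (ht : 0 ≤ t) : Continuous (S.ud t) := by
  have : S.ud t = fun x => Aop S.ν (S.u t) x / S.ν x := by
    ext x
    rw [eq_div_iff (S.νpos x).ne', S.pde t ht x]
  rw [this]
  exact (Aop_cont S.νC (S.uC t ht)).div S.νC.continuous fun x => (S.νpos x).ne'

theorem ud_meas (S : Sys n) :
    Measurable (fun p : ℝ × EuclideanSpace ℝ (Fin n) => S.ud (max p.1 0) p.2) := by
  refine measurable_uncurry_of_continuous_of_measurable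
    (u := fun (t : ℝ) x => S.ud (max t 0) x) (fun x => ?_) fun t => ?_
  · exact (S.udc x).comp (continuous_id.max continuous_const)
  · exact (ud_cont S (le_max_right _ _)).measurable

theorem integrand_meas (hψ : Cut ψ) (hη : Adm Ω η η1 η2 B) (hr : RA S Ω r) :
    Measurable (fun p : ℝ × EuclideanSpace ℝ (Fin n) => ψ p.2 * S.ν p.2 *
      (η1 (S.u (max p.1 0) p.2 - r p.2) * S.ud (max p.1 0) p.2)) := by
  have h1 : Measurable (fun p : ℝ × EuclideanSpace ℝ (Fin n) => S.u (max p.1 0) p.2 - r p.2) :=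
    (u_meas S).sub (hr.C.continuous.measurable.comp measurable_snd)
  have h2 : Measurable (fun p : ℝ × EuclideanSpace ℝ (Fin n) =>
      η1 (S.u (max p.1 0) p.2 - r p.2)) := by
    have h3 : Measurable (fun p : ℝ × EuclideanSpace ℝ (Fin n) =>
      (⟨S.u (max p.1 0) p.2 - r p.2, hr.mem _ (le_max_right _ _) _⟩ : Ω)) := h1.subtype_mk
    exact (continuousOn_iff_continuous_domRestrict.1 hη.C1.continuousOn).measurable.comp h3
  exact ((hψ.C.continuous.measurable.comp measurable_snd).mul
    (S.νC.continuous.measurable.comp measurable_snd)).mul (h2.mul (ud_meas S))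

theorem D_meas (hψ : Cut ψ) (hη : Adm Ω η η1 η2 B) (hr : RA S Ω r) {s : Set ℝ}
    (hs : s ⊆ Ici 0) (hms : MeasurableSet s) :
    AEStronglyMeasurable (Dis S ψ r η1) (volume.restrict s) := by
  have h := (integrand_meas hψ hη hr).stronglyMeasurable.integral_prod_right' (ν := volume)
  refine h.aestronglyMeasurable.congr ?_
  filter_upwards [ae_restrict_mem hms] with t ht
  have ht' : max t 0 = t := max_eq_left (hs ht)
  simp only [ht']
  rfl

end
end FPE

namespace FPE
open Set Filter Topology

theorem adm_sqrt {ε : ℝ} (hε : 0 < ε) : Adm univ (fun v => √(v ^ 2 + ε ^ 2) - ε)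
    (fun v => v / √(v ^ 2 + ε ^ 2)) (fun v => ε ^ 2 / √(v ^ 2 + ε ^ 2) ^ 3) 1 := by
  have hp : ∀ v : ℝ, 0 < v ^ 2 + ε ^ 2 := fun v => by positivity
  have hd : ∀ v : ℝ, HasDerivAt (fun v => √(v ^ 2 + ε ^ 2)) (v / √(v ^ 2 + ε ^ 2)) v := by
    intro v
    have h1 : HasDerivAt (fun v : ℝ => v ^ 2 + ε ^ 2) (2 * v) v := by
      simpa using (hasDerivAt_pow 2 v).add_const (ε ^ 2)
    have h2 := h1.sqrt (hp v).ne'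
    convert h2 using 1
    rw [mul_div_mul_left _ _ two_ne_zero]
  refine ⟨isOpen_univ, convex_univ, fun v _ => (hd v).sub_const ε, fun v _ => ?_, ?_, ?_, ?_⟩
  · have h := (hasDerivAt_id v).div (hd v) (Real.sqrt_pos.2 (hp v)).ne'
    have hs := Real.sq_sqrt (hp v).le
    have hs0 := (Real.sqrt_pos.2 (hp v)).ne'
    have e : ε ^ 2 / √(v ^ 2 + ε ^ 2) ^ 3 =
        (1 * √(v ^ 2 + ε ^ 2) - id v * (v / √(v ^ 2 + ε ^ 2))) / √(v ^ 2 + ε ^ 2) ^ 2 := by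
      rw [id_eq]
      field_simp
      rw [hs]; ring
    rw [e]
    exact h
  · refine Continuous.continuousOn (continuous_const.div (by fun_prop) fun v => ?_)
    exact (pow_pos (Real.sqrt_pos.2 (hp v)) 3).ne'
  · intro v _; positivity
  · intro v _
    rw [abs_div, abs_of_pos (Real.sqrt_pos.2 (hp v)), div_le_one (Real.sqrt_pos.2 (hp v))]
    exact Real.abs_le_sqrt (by nlinarith [sq_nonneg ε])

section
variable {n : ℕ}

/-- the integrated chain rule between two times -/
def Idn (S : Sys n) (ψ : EuclideanSpace ℝ (Fin n) → ℝ) (s t : ℝ) : Prop :=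
  ∀ (Ω : Set ℝ) (η η1 η2 : ℝ → ℝ) (B : ℝ) (r : EuclideanSpace ℝ (Fin n) → ℝ),
    Adm Ω η η1 η2 B → RA S Ω r → IntervalIntegrable (Dis S ψ r η1) volume s t ∧
      Fun S ψ r η t - Fun S ψ r η s = ∫ τ in s..t, Dis S ψ r η1 τ

variable {S : Sys n} {ψ : EuclideanSpace ℝ (Fin n) → ℝ}

theorem Idn.refl (s : ℝ) : Idn S ψ s s := fun _ _ _ _ _ _ _ _ => ⟨by simp, by simp⟩

theorem Idn.trans {s t w : ℝ} (h1 : Idn S ψ s t) (h2 : Idn S ψ t w) : Idn S ψ s w := by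
  intro Ω η η1 η2 B r hη hr
  obtain ⟨a1, b1⟩ := h1 Ω η η1 η2 B r hη hr
  obtain ⟨a2, b2⟩ := h2 Ω η η1 η2 B r hη hr
  refine ⟨a1.trans a2, ?_⟩
  rw [← intervalIntegral.integral_add_adjacent_intervals a1 a2, ← b1, ← b2]; ring

def Reg (S : Sys n) (ψ : EuclideanSpace ℝ (Fin n) → ℝ) (y : ℝ) : Prop :=
  ∃ δ > 0, ∀ s t, 0 ≤ s → s ≤ t → y - δ < s → t < y + δ → Idn S ψ s t

theorem chain {s t : ℝ} (hs : 0 ≤ s) (hst : s ≤ t) (h : ∀ y ∈ Icc s t, Reg S ψ y) :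
    Idn S ψ s t := by
  choose! δ hδ hI using h
  obtain ⟨p, hp0, hpm, ⟨m, hm⟩, hp⟩ := exists_monotone_Icc_subset_open_cover_Icc hst
    (c := fun y : Icc s t => {z : Icc s t | (z : ℝ) ∈ Ioo (y - δ y) (y + δ y)})
    (fun y => isOpen_Ioo.preimage continuous_subtype_val)
    (fun y _ => mem_iUnion.2 ⟨y, by
      have := hδ y y.2
      simp only [Set.mem_ofPred_eq, mem_Ioo]; constructor <;> linarith⟩)
  have key : ∀ k, Idn S ψ s (p k) := by
    intro k
    induction k with
    | zero => rw [hp0]; exact Idn.refl _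
    | succ k ih =>
      refine ih.trans ?_
      obtain ⟨y, hy⟩ := hp k
      have hle : p k ≤ p (k + 1) := hpm (Nat.le_succ k)
      have h1 := hy (left_mem_Icc.2 hle)
      have h2 := hy (right_mem_Icc.2 hle)
      exact hI y y.2 _ _ (hs.trans (p k).2.1) hle h1.1 h2.2
  have := key m
  rwa [hm m le_rfl] at this

theorem gap (hψ : Cut ψ) {a b : ℝ} (ha : 0 ≤ a) (hab : a < b)
    (h : ∀ a' b', a < a' → a' ≤ b' → b' < b → Idn S ψ a' b') : Idn S ψ a b := by
  intro Ω η η1 η2 B r hη hr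
  obtain ⟨M, hM⟩ := D_le_const hψ hη hr
  set δ : ℕ → ℝ := fun i => (b - a) / ((i : ℝ) + 3) with hδ
  have hδ0 : ∀ i, 0 < δ i := fun i => div_pos (by linarith) (by positivity)
  have hδ1 : ∀ i, δ i ≤ (b - a) / 3 := fun i => by
    refine div_le_div_of_nonneg_left (by linarith) (by norm_num) ?_
    have : (0 : ℝ) ≤ i := Nat.cast_nonneg i
    linarith
  have hδt : Tendsto δ atTop (𝓝 0) := by
    refine tendsto_const_nhds.div_atTop ?_
    exact tendsto_atTop_add_const_right _ _ tendsto_natCast_atTop_atTop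
  have hat : Tendsto (fun i => a + δ i) atTop (𝓝 a) := by simpa using hδt.const_add a
  have hbt : Tendsto (fun i => b - δ i) atTop (𝓝 b) := by simpa using hδt.const_sub b
  have hle : ∀ i, a + δ i ≤ b - δ i := fun i => by linarith [hδ1 i]
  have hid : ∀ i, Idn S ψ (a + δ i) (b - δ i) := fun i =>
    h _ _ (by linarith [hδ0 i]) (hle i) (by linarith [hδ0 i])
  have hF := F_cont hψ hη hr
  have hFt : Tendsto (fun i => Fun S ψ r η (b - δ i) - Fun S ψ r η (a + δ i)) atTop
      (𝓝 (Fun S ψ r η b - Fun S ψ r η a)) := by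
    refine Tendsto.sub ?_ ?_
    · refine (hF b (by simp; linarith)).tendsto.comp (tendsto_nhdsWithin_iff.2 ⟨hbt, ?_⟩)
      exact Eventually.of_forall fun i => by
        simp only [mem_Ici]; linarith [hδ1 i]
    · refine (hF a ha).tendsto.comp (tendsto_nhdsWithin_iff.2 ⟨hat, ?_⟩)
      exact Eventually.of_forall fun i => by
        simp only [mem_Ici]; linarith [hδ0 i]
  have hint : ∀ i, IntervalIntegrable (fun τ => M - Dis S ψ r η1 τ) volume (a + δ i) (b - δ i) :=
    fun i => intervalIntegrable_const.sub (hid i Ω η η1 η2 B r hη hr).1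
  have hval : ∀ i, ∫ τ in (a + δ i)..(b - δ i), (M - Dis S ψ r η1 τ) =
      M * ((b - δ i) - (a + δ i)) - (Fun S ψ r η (b - δ i) - Fun S ψ r η (a + δ i)) := by
    intro i
    rw [intervalIntegral.integral_sub intervalIntegrable_const (hid i Ω η η1 η2 B r hη hr).1,
      (hid i Ω η η1 η2 B r hη hr).2]
    simp; ring
  have hIoc : IntegrableOn (fun τ => M - Dis S ψ r η1 τ) (Ioc a b) := by
    have hlim : Tendsto (fun i => M * ((b - δ i) - (a + δ i)) -
        (Fun S ψ r η (b - δ i) - Fun S ψ r η (a + δ i))) atTop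
        (𝓝 (M * (b - a) - (Fun S ψ r η b - Fun S ψ r η a))) :=
      ((hbt.sub hat).const_mul M).sub hFt
    refine integrableOn_Ioc_of_intervalIntegral_norm_bounded
      (I := M * (b - a) - (Fun S ψ r η b - Fun S ψ r η a) + 1)
      (fun i => (intervalIntegrable_iff_integrableOn_Ioc_of_le (hle i)).1 (hint i)) hat hbt ?_
    filter_upwards [hlim.eventually (gt_mem_nhds (lt_add_one _))] with i hi
    refine le_trans (le_of_eq ?_) hi.le
    rw [← hval i, intervalIntegral.integral_of_le (hle i)]
    refine setIntegral_congr_fun measurableSet_Ioc fun τ hτ => ?_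
    have : 0 ≤ τ := by linarith [hτ.1, hδ0 i]
    exact Real.norm_of_nonneg (by linarith [hM τ this])
  have hD : IntervalIntegrable (Dis S ψ r η1) volume a b := by
    have h1 : IntervalIntegrable (fun τ => M - Dis S ψ r η1 τ) volume a b :=
      (intervalIntegrable_iff_integrableOn_Ioc_of_le hab.le).2 hIoc
    have h2 := (intervalIntegrable_const (c := M) (a := a) (b := b) (μ := volume)).sub h1
    exact h2.congr (fun τ _ => by simp)
  refine ⟨hD, ?_⟩
  have hP := intervalIntegral.continuousOn_primitive_interval' hD left_mem_uIcc
  rw [uIcc_of_le hab.le] at hP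
  have ht : Tendsto (fun i => (∫ τ in a..(b - δ i), Dis S ψ r η1 τ)
      - ∫ τ in a..(a + δ i), Dis S ψ r η1 τ) atTop
      (𝓝 ((∫ τ in a..b, Dis S ψ r η1 τ) - ∫ τ in a..a, Dis S ψ r η1 τ)) := by
    refine Tendsto.sub ?_ ?_
    · refine (hP b (right_mem_Icc.2 hab.le)).tendsto.comp (tendsto_nhdsWithin_iff.2 ⟨hbt, ?_⟩)
      exact Eventually.of_forall fun i => ⟨by linarith [hδ1 i], by linarith [hδ0 i]⟩
    · refine (hP a (left_mem_Icc.2 hab.le)).tendsto.comp (tendsto_nhdsWithin_iff.2 ⟨hat, ?_⟩)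
      exact Eventually.of_forall fun i => ⟨by linarith [hδ0 i], by linarith [hδ1 i]⟩
  rw [intervalIntegral.integral_same, sub_zero] at ht
  refine tendsto_nhds_unique hFt (ht.congr fun i => ?_)
  rw [(hid i Ω η η1 η2 B r hη hr).2, sub_eq_iff_eq_add', intervalIntegral.integral_add_adjacent_intervals]
  · refine hD.mono_set ?_
    rw [uIcc_of_le hab.le, uIcc_of_le (by linarith [hδ0 i])]
    exact Icc_subset_Icc_right (by linarith [hδ1 i])
  · exact (hid i Ω η η1 η2 B r hη hr).1

theorem psinu_int (hψ : Cut ψ) (S : Sys n) : Integrable (fun x => ψ x * S.ν x) :=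
  (hψ.C.continuous.mul S.νC.continuous).integrable_of_hasCompactSupport hψ.c.mul_right

theorem kato (hψ : Cut ψ) {a b c k : ℝ} (ha : 0 ≤ a) (hab : a < b) (hc0 : 0 ≤ c)
    (hc : ∀ x, |Aop S.ν ψ x| ≤ c * S.ν x) (hI : Idn S ψ a b)
    (hk : ∀ x, ψ x ≠ 0 → |S.ud a x| ≤ k) :
    ∫ x, ψ x * S.ν x * |S.u b x - S.u a x| ≤ (2 * c + k * ∫ x, ψ x * S.ν x) * (b - a) := by
  have hb : 0 ≤ b := ha.trans hab.le
  have hr : RA S univ (S.u a) := ⟨S.uC a ha, S.uint a ha, fun _ _ _ => mem_univ _⟩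
  have hu1 : ∫ x, |S.u a x| * S.ν x = 1 := by
    rw [← S.umass a ha]
    exact integral_congr_ae (Eventually.of_forall fun x => by
      simp only; rw [abs_of_pos (S.upos a ha x)])
  refine le_of_forall_pos_le_add fun ε' hε' => ?_
  have hψν : 0 ≤ ∫ x, ψ x * S.ν x := integral_nonneg fun x => mul_nonneg (hψ.pos x) (S.νpos x).le
  set ε := ε' / ((∫ x, ψ x * S.ν x) + 1) with hεd
  have hε : 0 < ε := by positivity
  have hεle : ε * (∫ x, ψ x * S.ν x) ≤ ε' := by
    rw [hεd, div_mul_eq_mul_div, div_le_iff₀ (by positivity)]; nlinarith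
  have hA := adm_sqrt hε
  obtain ⟨h1, h2⟩ := hI _ _ _ _ _ _ hA hr
  have hη0 : ∀ v : ℝ, |√(v ^ 2 + ε ^ 2) - ε| ≤ |v| := by
    intro v
    have h3 : ε ≤ √(v ^ 2 + ε ^ 2) := Real.le_sqrt_of_sq_le (by nlinarith [sq_nonneg v])
    rw [abs_of_nonneg (by linarith), sub_le_iff_le_add]
    refine Real.sqrt_le_iff.2 ⟨by positivity, ?_⟩
    nlinarith [sq_abs v, abs_nonneg v, mul_nonneg (abs_nonneg v) hε.le]
  have hFa : Fun S ψ (S.u a) (fun v => √(v ^ 2 + ε ^ 2) - ε) a = 0 := by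
    unfold Fun
    simp [Real.sqrt_sq hε.le]
  have hD : ∀ τ ∈ Icc a b, Dis S ψ (S.u a) (fun v => v / √(v ^ 2 + ε ^ 2)) τ ≤
      2 * c + k * ∫ x, ψ x * S.ν x := by
    intro τ hτ
    have hτ0 : 0 ≤ τ := ha.trans hτ.1
    refine (D_le hψ hA hr hc hτ0).trans (add_le_add ?_ ?_)
    · rw [mul_comm]
      refine mul_le_mul_of_nonneg_right ?_ hc0
      have h3 := v_int_le hr hτ0
      rw [hu1] at h3
      refine le_trans ?_ (h3.trans (by norm_num))
      refine integral_mono (eta_int hA hr hτ0) (v_int hr hτ0) fun x => ?_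
      exact mul_le_mul_of_nonneg_right (hη0 _) (S.νpos x).le
    · rw [one_mul, ← integral_const_mul]
      refine integral_mono ?_ ((psinu_int hψ S).const_mul k) fun x => ?_
      · exact (hψ.C.continuous.mul (Aop_cont S.νC hr.C).abs).integrable_of_hasCompactSupport
          hψ.c.mul_right
      · simp only
        rw [← S.pde a ha, abs_mul, abs_of_pos (S.νpos x)]
        by_cases hx : ψ x = 0
        · simp [hx]
        · have := mul_le_mul_of_nonneg_right (hk x hx) (mul_nonneg (hψ.pos x) (S.νpos x).le)
          linarith
  have hFb : Fun S ψ (S.u a) (fun v => √(v ^ 2 + ε ^ 2) - ε) b ≤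
      (2 * c + k * ∫ x, ψ x * S.ν x) * (b - a) := by
    rw [hFa, sub_zero] at h2
    rw [h2]
    have := intervalIntegral.integral_mono_on hab.le h1
      (intervalIntegrable_const (c := 2 * c + k * ∫ x, ψ x * S.ν x)) hD
    refine this.trans (le_of_eq ?_)
    simp; ring
  have hle : ∫ x, ψ x * S.ν x * |S.u b x - S.u a x| ≤
      Fun S ψ (S.u a) (fun v => √(v ^ 2 + ε ^ 2) - ε) b + ε * ∫ x, ψ x * S.ν x := by
    unfold Fun
    rw [← integral_const_mul, ← integral_add (F_int hψ hA hr hb) ((psinu_int hψ S).const_mul ε)]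
    refine integral_mono (psi_uu_int hψ S hb ha)
      ((F_int hψ hA hr hb).add ((psinu_int hψ S).const_mul ε)) fun x => ?_
    simp only
    have h3 : |S.u b x - S.u a x| ≤ √((S.u b x - S.u a x) ^ 2 + ε ^ 2) :=
      Real.abs_le_sqrt (by nlinarith [sq_nonneg ε])
    have := mul_le_mul_of_nonneg_left h3 (mul_nonneg (hψ.pos x) (S.νpos x).le)
    linarith
  linarith

end

/-- gaps of a closed set -/
theorem gaps {K : Set ℝ} (hK : IsClosed K) {s t : ℝ} (hKs : K ⊆ Icc s t) (hs : s ∈ K) (ht : t ∈ K) :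
    ∃ (A : Set ℝ) (b : ℝ → ℝ), A.Countable ∧
      (∀ a ∈ A, a ∈ K ∧ b a ∈ K ∧ a < b a ∧ Ioo a (b a) ∩ K = ∅) ∧
      Pairwise (Function.onFun Disjoint fun a : A => Ioo (a : ℝ) (b a)) ∧
      Icc s t = K ∪ ⋃ a : A, Ioo (a : ℝ) (b a) := by
  let A : Set ℝ := {a | a ∈ K ∧ ∃ c, c ∈ K ∧ a < c ∧ Ioo a c ∩ K = ∅}
  have hA : ∀ a ∈ A, ∃ c, c ∈ K ∧ a < c ∧ Ioo a c ∩ K = ∅ := fun a ha => ha.2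
  choose! b hb1 hb2 hb3 using hA
  have hlt : ∀ a ∈ A, ∀ a' ∈ A, a < a' → b a ≤ a' := by
    intro a ha a' ha' h
    by_contra hcon
    push Not at hcon
    have : a' ∈ Ioo a (b a) ∩ K := ⟨⟨h, hcon⟩, ha'.1⟩
    rw [hb3 a ha] at this
    exact this
  have hdis : A.PairwiseDisjoint fun a => Ioo a (b a) := by
    intro a ha a' ha' hne
    rcases lt_or_gt_of_ne hne with h | h
    · exact Set.disjoint_left.2 fun y hy hy' => by
        have := hlt a ha a' ha' h
        linarith [hy.2, hy'.1]
    · exact Set.disjoint_left.2 fun y hy hy' => by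
        have := hlt a' ha' a ha h
        linarith [hy.1, hy'.2]
  refine ⟨A, b, hdis.countable_of_Ioo hb2, fun a ha => ⟨ha.1, hb1 a ha, hb2 a ha, hb3 a ha⟩, ?_, ?_⟩
  · intro a a' hne
    exact hdis a.2 a'.2 (fun h => hne (Subtype.ext h))
  · refine Subset.antisymm (fun y hy => ?_) (union_subset hKs (iUnion_subset fun a y hy => ?_))
    · by_cases hyK : y ∈ K
      · exact Or.inl hyK
      refine Or.inr ?_
      have hL : IsCompact (K ∩ Icc s y) := isCompact_Icc.inter_left hK
      have hR : IsCompact (K ∩ Icc y t) := isCompact_Icc.inter_left hK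
      obtain ⟨a, ha, haM⟩ := hL.exists_isGreatest ⟨s, hs, le_rfl, hy.1⟩
      obtain ⟨c, hc, hcM⟩ := hR.exists_isLeast ⟨t, ht, hy.2, le_rfl⟩
      have hay : a < y := lt_of_le_of_ne ha.2.2 fun h => hyK (h ▸ ha.1)
      have hyc : y < c := lt_of_le_of_ne hc.2.1 fun h => hyK (h ▸ hc.1)
      have hac : Ioo a c ∩ K = ∅ := by
        ext z
        simp only [mem_inter_iff, mem_Ioo, mem_empty_iff_false, iff_false]
        rintro ⟨⟨h1, h2⟩, h3⟩
        rcases le_total z y with h | h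
        · exact absurd (haM ⟨h3, (hKs h3).1, h⟩) (not_le.2 h1)
        · exact absurd (hcM ⟨h3, h, (hKs h3).2⟩) (not_le.2 h2)
      have haA : a ∈ A := ⟨ha.1, c, hc.1, hay.trans hyc, hac⟩
      refine mem_iUnion.2 ⟨⟨a, haA⟩, hay, ?_⟩
      by_contra hcon
      push Not at hcon
      have h4 : b a ∈ Ioo a c ∩ K := ⟨⟨hb2 a haA, hcon.trans_lt hyc⟩, hb1 a haA⟩
      rw [hac] at h4
      exact h4
    · exact ⟨(hKs a.2.1).1.trans hy.1.le, hy.2.le.trans (hKs (hb1 a a.2)).2⟩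

end FPE

namespace FPE
open Set Filter Topology

theorem hs_congr {ι : Type*} {f g : ι → ℝ} {a : ℝ} (h : ∀ i, f i = g i) (hg : HasSum g a) :
    HasSum f a := by
  rw [funext h]; exact hg

theorem gap_split {K : Set ℝ} (hK : IsClosed K) {s t : ℝ} {A : Set ℝ} {b : ℝ → ℝ} (hAc : A.Countable)
    (hA : ∀ a ∈ A, a ∈ K ∧ b a ∈ K ∧ a < b a ∧ Ioo a (b a) ∩ K = ∅)
    (hdis : Pairwise (Function.onFun Disjoint fun a : A => Ioo (a : ℝ) (b a)))
    (hU : Icc s t = K ∪ ⋃ a : A, Ioo (a : ℝ) (b a)) {g : ℝ → ℝ} (hg : IntegrableOn g (Icc s t)) :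
    HasSum (fun a : A => ∫ τ in (a : ℝ)..(b a), g τ) ((∫ τ in Icc s t, g τ) - ∫ τ in K, g τ) := by
  have : Countable A := hAc
  have hg1 : IntegrableOn g K := hg.mono_set (by rw [hU]; exact subset_union_left)
  have hg2 : IntegrableOn g (⋃ a : A, Ioo (a : ℝ) (b a)) :=
    hg.mono_set (by rw [hU]; exact subset_union_right)
  have h := hasSum_integral_iUnion (fun a : A => measurableSet_Ioo) hdis hg2
  have hd : Disjoint K (⋃ a : A, Ioo (a : ℝ) (b a)) := by
    rw [Set.disjoint_iUnion_right]
    intro a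
    rw [disjoint_comm, Set.disjoint_iff_inter_eq_empty]
    exact (hA a a.2).2.2.2
  have e : (∫ τ in Icc s t, g τ) - ∫ τ in K, g τ = ∫ τ in ⋃ a : A, Ioo (a : ℝ) (b a), g τ := by
    rw [hU, setIntegral_union hd (MeasurableSet.iUnion fun _ => measurableSet_Ioo) hg1 hg2]; ring
  rw [e]
  refine hs_congr (fun a => ?_) h
  rw [intervalIntegral.integral_of_le (hA a a.2).2.2.1.le, integral_Ioc_eq_integral_Ioo]

section
variable {n : ℕ} {S : Sys n} {ψ : EuclideanSpace ℝ (Fin n) → ℝ}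

theorem K_prod_int {Ω : Set ℝ} {η η1 η2 : ℝ → ℝ} {B : ℝ} {r : EuclideanSpace ℝ (Fin n) → ℝ}
    (hψ : Cut ψ) (hη : Adm Ω η η1 η2 B) (hr : RA S Ω r) {K : Set ℝ} (hK : IsClosed K) {s t k : ℝ}
    (hs0 : 0 ≤ s) (hKs : K ⊆ Icc s t) (hk : ∀ τ ∈ K, ∀ x, ψ x ≠ 0 → |S.ud τ x| ≤ k) :
    Integrable (fun p : ℝ × EuclideanSpace ℝ (Fin n) => ψ p.2 * S.ν p.2 *
      (η1 (S.u (max p.1 0) p.2 - r p.2) * S.ud (max p.1 0) p.2))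
      ((volume.restrict K).prod volume) := by
  have : IsFiniteMeasure (volume.restrict K) :=
    ⟨by rw [Measure.restrict_apply_univ]; exact (measure_mono hKs).trans_lt measure_Icc_lt_top⟩
  have h0 : Integrable (fun p : ℝ × EuclideanSpace ℝ (Fin n) => (1 : ℝ) * ((B * k) * (ψ p.2 * S.ν p.2)))
      ((volume.restrict K).prod volume) :=
    (integrable_const (1 : ℝ)).mul_prod ((psinu_int hψ S).const_mul (B * k))
  refine h0.mono' (integrand_meas hψ hη hr).aestronglyMeasurable ?_
  have hae : ∀ᵐ p ∂((volume.restrict K).prod (volume : Measure (EuclideanSpace ℝ (Fin n)))), p.1 ∈ K :=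
    Measure.quasiMeasurePreserving_fst.ae (ae_restrict_mem hK.measurableSet)
  filter_upwards [hae] with p hp
  have hp0 : 0 ≤ p.1 := hs0.trans (hKs hp).1
  rw [max_eq_left hp0, one_mul]
  by_cases hx : ψ p.2 = 0
  · simp [hx]
  have h1 := hη.bd _ (hr.mem p.1 hp0 p.2)
  have h2 := hk p.1 hp p.2 hx
  have h3 : 0 ≤ ψ p.2 * S.ν p.2 := mul_nonneg (hψ.pos _) (S.νpos _).le
  rw [Real.norm_eq_abs, abs_mul, abs_of_nonneg h3, abs_mul, mul_comm]
  exact mul_le_mul_of_nonneg_right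
    (mul_le_mul h1 h2 (abs_nonneg _) ((abs_nonneg _).trans h1)) h3

theorem glue (hψ : Cut ψ) {K : Set ℝ} (hK : IsClosed K) {s t k : ℝ} (hs0 : 0 ≤ s) (hst : s ≤ t)
    (hKs : K ⊆ Icc s t) (hsK : s ∈ K) (htK : t ∈ K)
    (hk : ∀ τ ∈ K, ∀ x, ψ x ≠ 0 → |S.ud τ x| ≤ k)
    (hg : ∀ a b, a ∈ K → b ∈ K → a < b → Ioo a b ∩ K = ∅ → Idn S ψ a b) : Idn S ψ s t := by
  intro Ω η η1 η2 B r hη hr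
  obtain ⟨A, b, hAc, hA, hdis, hU⟩ := gaps hK hKs hsK htK
  have : Countable A := hAc
  have hB : 0 ≤ B := (abs_nonneg _).trans (hη.bd _ (hr.mem s hs0 0))
  obtain ⟨M, hM⟩ := D_le_const hψ hη hr
  obtain ⟨c, hc0, hc⟩ := cpsi S hψ
  have hA0 : ∀ a : A, 0 ≤ (a : ℝ) := fun a => hs0.trans (hKs (hA a a.2).1).1
  have hb0 : ∀ a : A, 0 ≤ b a := fun a => hs0.trans (hKs (hA a a.2).2.1).1
  have hab : ∀ a : A, (a : ℝ) < b a := fun a => (hA a a.2).2.2.1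
  have hI : ∀ a : A, Idn S ψ a (b a) := fun a =>
    hg a (b a) (hA a a.2).1 (hA a a.2).2.1 (hab a) (hA a a.2).2.2.2
  have hlen : Summable (fun a : A => b a - (a : ℝ)) := by
    have := (gap_split hK hAc hA hdis hU (g := fun _ => (1 : ℝ)) (by simp)).summable
    simpa using this
  have hprod := K_prod_int hψ hη hr hK hs0 hKs hk
  have hDK : IntegrableOn (Dis S ψ r η1) K := by
    refine hprod.integral_prod_left.congr ?_
    filter_upwards [ae_restrict_mem hK.measurableSet] with τ hτ
    simp only [max_eq_left (hs0.trans (hKs hτ).1)]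
    rfl
  -- the sum over the gaps
  let Φ : A → EuclideanSpace ℝ (Fin n) → ℝ := fun a x =>
    ψ x * S.ν x * η (S.u (b a) x - r x) - ψ x * S.ν x * η (S.u a x - r x)
  have hΦi : ∀ a, Integrable (Φ a) := fun a =>
    (F_int hψ hη hr (hb0 a)).sub (F_int hψ hη hr (hA0 a))
  have hΦs : Summable (fun a => ∫ x, ‖Φ a x‖) := by
    refine Summable.of_nonneg_of_le (fun a => integral_nonneg fun x => norm_nonneg _) (fun a => ?_)
      (hlen.mul_left (B * (2 * c + k * ∫ x, ψ x * S.ν x)))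
    refine (F_lip hψ hη hr (hb0 a) (hA0 a)).trans ?_
    rw [mul_assoc]
    exact mul_le_mul_of_nonneg_left
      (kato hψ (hA0 a) (hab a) hc0 hc (hI a) (hk a (hA a a.2).1)) hB
  have hΦ := hasSum_integral_of_summable_integral_norm hΦi hΦs
  have hpt : ∀ x, ∑' a, Φ a x = ψ x * S.ν x * η (S.u t x - r x) - ψ x * S.ν x * η (S.u s x - r x)
      - ∫ τ in K, ψ x * S.ν x * (η1 (S.u (max τ 0) x - r x) * S.ud (max τ 0) x) := by
    intro x
    refine HasSum.tsum_eq ?_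
    have hcu : Continuous (fun τ => S.u τ x) :=
      continuous_iff_continuousAt.2 fun t => (S.hud x t).continuousAt
    have hcd : ContinuousOn (fun τ => ψ x * S.ν x * (η1 (S.u τ x - r x) * S.ud τ x)) (Icc s t) := by
      refine continuousOn_const.mul (ContinuousOn.mul ?_ (S.udc x).continuousOn)
      refine hη.C1.continuousOn.comp (hcu.sub continuous_const).continuousOn fun τ hτ => ?_
      exact hr.mem τ (hs0.trans hτ.1) x
    have hdq : ∀ τ, 0 ≤ τ → HasDerivAt (fun τ => ψ x * S.ν x * η (S.u τ x - r x))
        (ψ x * S.ν x * (η1 (S.u τ x - r x) * S.ud τ x)) τ := by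
      intro τ hτ
      refine HasDerivAt.const_mul _ ?_
      exact HasDerivAt.comp (h₂ := η) τ (hη.d1 _ (hr.mem τ hτ x)) ((S.hud x τ).sub_const _)
    have hftc : ∀ a' b', a' ∈ Icc s t → b' ∈ Icc s t → a' ≤ b' →
        ∫ τ in a'..b', ψ x * S.ν x * (η1 (S.u τ x - r x) * S.ud τ x) =
        ψ x * S.ν x * η (S.u b' x - r x) - ψ x * S.ν x * η (S.u a' x - r x) := by
      intro a' b' ha' hb' hle
      refine intervalIntegral.integral_eq_sub_of_hasDerivAt
        (f := fun τ => ψ x * S.ν x * η (S.u τ x - r x)) (fun τ hτ => ?_) ?_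
      · rw [uIcc_of_le hle] at hτ
        exact hdq τ (hs0.trans (ha'.1.trans hτ.1))
      · refine ContinuousOn.intervalIntegrable (hcd.mono ?_)
        rw [uIcc_of_le hle]
        exact Icc_subset_Icc ha'.1 hb'.2
    have h := gap_split hK hAc hA hdis hU (hcd.integrableOn_compact isCompact_Icc)
    rw [integral_Icc_eq_integral_Ioc, ← intervalIntegral.integral_of_le hst,
      hftc s t ⟨le_rfl, hst⟩ ⟨hst, le_rfl⟩ hst] at h
    have e : ∫ τ in K, ψ x * S.ν x * (η1 (S.u (max τ 0) x - r x) * S.ud (max τ 0) x) =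
        ∫ τ in K, ψ x * S.ν x * (η1 (S.u τ x - r x) * S.ud τ x) :=
      setIntegral_congr_fun hK.measurableSet fun τ hτ => by
        simp only [max_eq_left (hs0.trans (hKs hτ).1)]
    rw [e]
    refine hs_congr (fun a => ?_) h
    exact (hftc a (b a) (hKs (hA a a.2).1) (hKs (hA a a.2).2.1) (hab a).le).symm
  have hsumF : HasSum (fun a : A => Fun S ψ r η (b a) - Fun S ψ r η a)
      (Fun S ψ r η t - Fun S ψ r η s - ∫ τ in K, Dis S ψ r η1 τ) := by
    have e1 : (fun a : A => Fun S ψ r η (b a) - Fun S ψ r η a) = fun a => ∫ x, Φ a x := by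
      ext a
      exact (integral_sub (F_int hψ hη hr (hb0 a)) (F_int hψ hη hr (hA0 a))).symm
    have e2 : Fun S ψ r η t - Fun S ψ r η s - ∫ τ in K, Dis S ψ r η1 τ = ∫ x, ∑' a, Φ a x := by
      simp_rw [hpt]
      have hF : Integrable (fun x => ψ x * S.ν x * η (S.u t x - r x) -
          ψ x * S.ν x * η (S.u s x - r x)) :=
        (F_int hψ hη hr (hs0.trans hst)).sub (F_int hψ hη hr hs0)
      have hR : Integrable (fun x => ∫ τ in K, ψ x * S.ν x *
          (η1 (S.u (max τ 0) x - r x) * S.ud (max τ 0) x)) := hprod.integral_prod_right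
      rw [integral_sub hF hR,
        integral_sub (F_int hψ hη hr (hs0.trans hst)) (F_int hψ hη hr hs0)]
      congr 1
      have := integral_integral_swap (f := fun (τ : ℝ) (x : EuclideanSpace ℝ (Fin n)) =>
        ψ x * S.ν x * (η1 (S.u (max τ 0) x - r x) * S.ud (max τ 0) x)) hprod
      rw [← this]
      refine setIntegral_congr_fun hK.measurableSet fun τ hτ => ?_
      simp only [max_eq_left (hs0.trans (hKs hτ).1)]
      rfl
    rw [e1, e2]
    exact hΦ
  have hvI : ∀ a : A, ∫ τ in Ioo (a : ℝ) (b a), Dis S ψ r η1 τ = Fun S ψ r η (b a) - Fun S ψ r η a := by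
    intro a
    rw [(hI a Ω η η1 η2 B r hη hr).2, intervalIntegral.integral_of_le (hab a).le,
      integral_Ioc_eq_integral_Ioo]
  have hIoo : ∀ a : A, IntegrableOn (Dis S ψ r η1) (Ioo (a : ℝ) (b a)) := fun a =>
    ((intervalIntegrable_iff_integrableOn_Ioo_of_le (hab a).le).1 (hI a Ω η η1 η2 B r hη hr).1)
  have hMD : IntegrableOn (fun τ => M - Dis S ψ r η1 τ) (⋃ a : A, Ioo (a : ℝ) (b a)) := by
    refine integrableOn_iUnion_of_summable_integral_norm
      (fun a => ?_) ?_
    · exact (integrableOn_const (by simp)).sub (hIoo a)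
    · have := (hlen.mul_left M).sub hsumF.summable
      refine this.congr fun a => ?_
      have e : ∫ τ in Ioo (a : ℝ) (b a), ‖M - Dis S ψ r η1 τ‖ =
          ∫ τ in Ioo (a : ℝ) (b a), (M - Dis S ψ r η1 τ) :=
        setIntegral_congr_fun measurableSet_Ioo fun τ hτ =>
          Real.norm_of_nonneg (by linarith [hM τ ((hA0 a).trans hτ.1.le)])
      rw [e, integral_sub (integrable_const M) (hIoo a), hvI a]
      simp [(hab a).le]; ring
  have hDIcc : IntegrableOn (Dis S ψ r η1) (Icc s t) := by
    rw [hU]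
    refine hDK.union ?_
    have hfin : volume (⋃ a : A, Ioo (a : ℝ) (b a)) ≠ ⊤ := by
      refine ((measure_mono ?_).trans_lt (measure_Icc_lt_top (a := s) (b := t))).ne
      rw [hU]; exact subset_union_right
    have := (integrableOn_const (C := M) hfin).sub hMD
    refine this.congr_fun (fun τ _ => by simp) (MeasurableSet.iUnion fun _ => measurableSet_Ioo)
  refine ⟨(intervalIntegrable_iff_integrableOn_Icc_of_le hst).2 hDIcc, ?_⟩
  have h := gap_split hK hAc hA hdis hU hDIcc
  rw [integral_Icc_eq_integral_Ioc, ← intervalIntegral.integral_of_le hst] at h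
  have h' : HasSum (fun a : A => Fun S ψ r η (b a) - Fun S ψ r η a)
      ((∫ τ in s..t, Dis S ψ r η1 τ) - ∫ τ in K, Dis S ψ r η1 τ) := by
    refine hs_congr (fun a => ?_) h
    exact (hI a Ω η η1 η2 B r hη hr).2
  have := hsumF.unique h'
  linarith

end
end FPE

namespace FPE
open Set Filter Topology

section
variable {n : ℕ} {S : Sys n} {ψ : EuclideanSpace ℝ (Fin n) → ℝ}

theorem ud_bd (hψ : Cut ψ) (S : Sys n) {t : ℝ} (ht : 0 ≤ t) :
    ∃ C, ∀ x, ψ x ≠ 0 → |S.ud t x| ≤ C := by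
  obtain ⟨C, hC⟩ := hψ.c.isCompact.exists_bound_of_continuousOn (ud_cont S ht).continuousOn
  exact ⟨C, fun x hx => hC x (subset_tsupport ψ hx)⟩

theorem reg_all (hψ : Cut ψ) (y : ℝ) : Reg S ψ y := by
  set E : Set ℝ := {y | ¬ Reg S ψ y} with hE
  have hEo : IsClosed E := by
    rw [← isOpen_compl_iff, Metric.isOpen_iff]
    intro y hy
    have hy' : Reg S ψ y := by simpa [hE] using hy
    obtain ⟨δ, hδ, h⟩ := hy'
    refine ⟨δ / 2, by positivity, fun z hz => ?_⟩
    have hz' : Reg S ψ z := by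
      rw [Metric.mem_ball, Real.dist_eq, abs_lt] at hz
      exact ⟨δ / 2, by positivity, fun s t hs hst h1 h2 =>
        h s t hs hst (by linarith [hz.1]) (by linarith [hz.2])⟩
    simpa [hE] using hz'
  have hE0 : ∀ y ∈ E, 0 ≤ y := by
    intro y hy
    by_contra hneg
    push Not at hneg
    exact hy ⟨-y, by linarith, fun s t hs hst h1 h2 => by linarith⟩
  by_contra hcon
  have : Nonempty E := ⟨⟨y, hcon⟩⟩
  have : CompleteSpace E := hEo.completeSpace_coe
  let f : ℕ → Set E := fun k => {τ : E | ∀ x, ψ x ≠ 0 → |S.ud τ x| ≤ k}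
  have hfc : ∀ k, IsClosed (f k) := by
    intro k
    have : f k = ⋂ x, ⋂ (_ : ψ x ≠ 0), {τ : E | |S.ud τ x| ≤ k} := by
      ext τ; simp [f]
    rw [this]
    refine isClosed_iInter fun x => isClosed_iInter fun _ => ?_
    exact isClosed_le ((S.udc x).comp continuous_subtype_val).abs continuous_const
  have hfU : ⋃ k, f k = univ := by
    refine eq_univ_of_forall fun τ => ?_
    obtain ⟨C, hC⟩ := ud_bd hψ S (hE0 τ τ.2)
    obtain ⟨k, hk⟩ := exists_nat_ge C
    exact mem_iUnion.2 ⟨k, fun x hx => (hC x hx).trans hk⟩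
  obtain ⟨k, t0, ht0⟩ := nonempty_interior_of_iUnion_of_closed hfc hfU
  obtain ⟨δ, hδ, hball⟩ := Metric.mem_nhds_iff.1 (mem_interior_iff_mem_nhds.1 ht0)
  refine t0.2 ⟨δ, hδ, fun s t hs hst h1 h2 => ?_⟩
  obtain ⟨C1, hC1⟩ := ud_bd hψ S hs
  obtain ⟨C2, hC2⟩ := ud_bd hψ S (hs.trans hst)
  have hKc : IsClosed (E ∩ Icc s t ∪ {s, t}) :=
    (hEo.inter isClosed_Icc).union (Set.toFinite _).isClosed
  have hKs : E ∩ Icc s t ∪ {s, t} ⊆ Icc s t := by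
    rintro τ (h | h | h)
    · exact h.2
    · rw [h]; exact ⟨le_rfl, hst⟩
    · rw [mem_singleton_iff.1 h]; exact ⟨hst, le_rfl⟩
  refine glue hψ hKc (k := max (k : ℝ) (max C1 C2)) hs hst hKs (by simp) (by simp) ?_ ?_
  · rintro τ (h | h | h) x hx
    · refine le_max_of_le_left ?_
      have hm : (⟨τ, h.1⟩ : E) ∈ Metric.ball t0 δ := by
        rw [Metric.mem_ball, Subtype.dist_eq, Real.dist_eq, abs_lt]
        constructor <;> simp only <;> linarith [h.2.1, h.2.2]
      exact hball hm x hx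
    · rw [h]; exact le_max_of_le_right (le_max_of_le_left (hC1 x hx))
    · rw [mem_singleton_iff.1 h]; exact le_max_of_le_right (le_max_of_le_right (hC2 x hx))
  · intro a b ha hb hab hemp
    have ha0 : 0 ≤ a := hs.trans (hKs ha).1
    refine gap hψ ha0 hab fun a' b' h3 h4 h5 => chain (ha0.trans h3.le) h4 fun y hy => ?_
    by_contra hreg
    have : y ∈ Ioo a b ∩ (E ∩ Icc s t ∪ {s, t}) :=
      ⟨⟨h3.trans_le hy.1, hy.2.trans_lt h5⟩, Or.inl ⟨hreg, (hKs ha).1.trans (h3.le.trans hy.1),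
        (hy.2.trans h5.le).trans (hKs hb).2⟩⟩
    rw [hemp] at this
    exact this

theorem idn_all (hψ : Cut ψ) {s t : ℝ} (hs : 0 ≤ s) (hst : s ≤ t) : Idn S ψ s t :=
  chain hs hst fun y _ => reg_all hψ y

end
end FPE

namespace FPE
open Set Filter Topology

theorem log_quot {δ k v : ℝ} (hδ : 0 < δ) (hk : δ < k) (hv : 0 < v) :
    |log (v + δ) - log (v + k)| ≤ (k - δ) / (v + δ) := by
  have h1 : log (v + δ) ≤ log (v + k) := Real.log_le_log (by linarith) (by linarith)
  rw [abs_sub_comm, abs_of_nonneg (by linarith), ← Real.log_div (by linarith) (by linarith)]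
  have h2 := Real.log_le_sub_one_of_pos (show 0 < (v + k) / (v + δ) from
    div_pos (by linarith) (by linarith))
  refine h2.trans (le_of_eq ?_)
  have : v + δ ≠ 0 := by linarith
  field_simp; ring

theorem adm_log {δ k : ℝ} (hδ : 0 < δ) (hk : δ < k) :
    Adm (Ioi 0) (fun v => (v + δ) * log (v + δ) - (v + k) * log (v + k))
      (fun v => log (v + δ) - log (v + k)) (fun v => (k - δ) / ((v + δ) * (v + k)))
      ((k - δ) / δ) := by
  have hd : ∀ a v : ℝ, 0 < a → 0 < v → HasDerivAt (fun v => log (v + a)) ((v + a)⁻¹) v := by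
    intro a v ha hv
    have h := ((hasDerivAt_id v).add_const a).log (show id v + a ≠ 0 by simp only [id_eq]; linarith)
    simpa using h
  have hd2 : ∀ a v : ℝ, 0 < a → 0 < v →
      HasDerivAt (fun v => (v + a) * log (v + a)) (log (v + a) + 1) v := by
    intro a v ha hv
    have h := ((hasDerivAt_id v).add_const a).mul (hd a v ha hv)
    have e : log (v + a) + 1 = 1 * log (v + a) + (id v + a) * (v + a)⁻¹ := by
      have : v + a ≠ 0 := by linarith
      rw [id_eq, mul_inv_cancel₀ this, one_mul]
    rw [e]; exact h
  have hk0 : 0 < k := hδ.trans hk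
  refine ⟨isOpen_Ioi, convex_Ioi 0, fun v hv => ?_, fun v hv => ?_, ?_, ?_, ?_⟩
  · have h := (hd2 δ v hδ hv).sub (hd2 k v hk0 hv)
    have e : log (v + δ) - log (v + k) = log (v + δ) + 1 - (log (v + k) + 1) := by ring
    rw [e]; exact h
  · have hv' : 0 < v := hv
    have h := (hd δ v hδ hv).sub (hd k v hk0 hv)
    have e : (k - δ) / ((v + δ) * (v + k)) = (v + δ)⁻¹ - (v + k)⁻¹ := by
      have : v + δ ≠ 0 := by linarith
      have : v + k ≠ 0 := by linarith
      field_simp; ring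
    rw [e]; exact h
  · refine ContinuousOn.div continuousOn_const (by fun_prop) fun v hv => ?_
    have hv' : 0 < v := hv
    positivity
  · intro v hv
    have hv' : 0 < v := hv
    exact div_nonneg (by linarith) (by positivity)
  · intro v hv
    have hv' : 0 < v := hv
    refine (log_quot hδ hk hv').trans ?_
    exact div_le_div_of_nonneg_left (by linarith) hδ (by linarith)

theorem adm_log_sq {δ k v : ℝ} (hδ : 0 < δ) (hk : δ < k) (hv : 0 < v) :
    (log (v + δ) - log (v + k)) ^ 2 ≤ ((k - δ) * k / δ) * ((k - δ) / ((v + δ) * (v + k))) := by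
  have h := log_quot hδ hk hv
  have h1 : (log (v + δ) - log (v + k)) ^ 2 ≤ ((k - δ) / (v + δ)) ^ 2 := by
    rw [← sq_abs]
    exact pow_le_pow_left₀ (abs_nonneg _) h 2
  refine h1.trans ?_
  have hk0 : 0 < k := hδ.trans hk
  rw [div_pow, div_mul_div_comm, div_le_div_iff₀ (by positivity) (by positivity)]
  have h2 : δ * (v + k) ≤ k * (v + δ) := by nlinarith
  have h3 : 0 ≤ (k - δ) ^ 2 * (v + δ) := by positivity
  nlinarith [mul_le_mul_of_nonneg_left h2 h3]

section
variable {n : ℕ} {S : Sys n}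

/-- cutoff functions exhausting the space -/
theorem cutoffs (n : ℕ) : ∃ (χ : ℕ → EuclideanSpace ℝ (Fin n) → ℝ) (C : ℝ),
    (∀ m, ContDiff ℝ 2 (χ m)) ∧ (∀ m, HasCompactSupport (χ m)) ∧ (∀ m x, 0 ≤ χ m x) ∧
    (∀ m x, χ m x ≤ 1) ∧ (∀ x, Tendsto (fun m => χ m x) atTop (𝓝 1)) ∧
    (∀ m i x, |pd i (χ m) x| ≤ C / ((m : ℝ) + 1)) := by
  let φ : ContDiffBump (0 : EuclideanSpace ℝ (Fin n)) := ⟨1, 2, by norm_num, by norm_num⟩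
  have hφ : ContDiff ℝ 2 (φ : EuclideanSpace ℝ (Fin n) → ℝ) := φ.contDiff
  have hφ1 : ContDiff ℝ 1 (φ : EuclideanSpace ℝ (Fin n) → ℝ) := φ.contDiff
  obtain ⟨C, hC⟩ := (φ.hasCompactSupport.fderiv ℝ).exists_bound_of_continuous
    (hφ1.continuous_fderiv (by norm_num))
  have hm : ∀ m : ℕ, ((m : ℝ) + 1)⁻¹ ≠ 0 := fun m => by positivity
  refine ⟨fun m x => φ (((m : ℝ) + 1)⁻¹ • x), C, fun m => ?_, fun m => ?_, fun m x => φ.nonneg,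
    fun m x => φ.le_one, fun x => ?_, fun m i x => ?_⟩
  · exact hφ.comp (contDiff_const_smul _)
  · exact φ.hasCompactSupport.comp_homeomorph (Homeomorph.smulOfNeZero _ (hm m))
  · refine tendsto_const_nhds.congr' ?_
    filter_upwards [eventually_ge_atTop ⌈‖x‖⌉₊] with m hmx
    symm
    refine φ.one_of_mem_closedBall ?_
    rw [mem_closedBall_zero_iff, norm_smul, norm_inv, Real.norm_of_nonneg (by positivity)]
    have : ‖x‖ ≤ m := Nat.ceil_le.1 hmx
    change _ ≤ (1 : ℝ)
    rw [inv_mul_le_iff₀ (by positivity)]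
    linarith
  · unfold pd
    have h := (hφ1.differentiable (by norm_num) (((m : ℝ) + 1)⁻¹ • x)).hasFDerivAt
    have h2 : HasFDerivAt (fun x : EuclideanSpace ℝ (Fin n) => ((m : ℝ) + 1)⁻¹ • x)
        (((m : ℝ) + 1)⁻¹ • ContinuousLinearMap.id ℝ _) x := (hasFDerivAt_id x).fun_const_smul _
    have h3 := (h.comp x h2).fderiv
    change fderiv ℝ (fun x => φ (((m : ℝ) + 1)⁻¹ • x)) x = _ at h3
    rw [h3]
    simp only [ContinuousLinearMap.comp_smul, ContinuousLinearMap.comp_id,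
      ContinuousLinearMap.smul_apply, smul_eq_mul]
    rw [abs_mul, abs_of_pos (by positivity), div_eq_inv_mul]
    refine mul_le_mul_of_nonneg_left ?_ (by positivity)
    have := (fderiv ℝ φ (((m : ℝ) + 1)⁻¹ • x)).le_opNorm (EuclideanSpace.single i 1)
    rw [Real.norm_eq_abs] at this
    refine this.trans ?_
    simpa using hC _

theorem Cut.sq {χ : EuclideanSpace ℝ (Fin n) → ℝ} (h1 : ContDiff ℝ 2 χ) (h2 : HasCompactSupport χ) :
    Cut (fun x => χ x * χ x) :=
  ⟨h1.mul h1, h2.mul_left, fun x => mul_self_nonneg _⟩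

theorem RA.zero (S : Sys n) : RA S (Ioi 0) (fun _ => 0) :=
  ⟨contDiff_const, by simp, fun t ht x => by simpa using S.upos t ht x⟩

theorem cut_ineq {χ : EuclideanSpace ℝ (Fin n) → ℝ} (h1 : ContDiff ℝ 2 χ) (h2 : HasCompactSupport χ)
    {η η1 η2 : ℝ → ℝ} {B c ε L : ℝ} (hη : Adm (Ioi 0) η η1 η2 B) (hc : 0 < c) (hε : 0 < ε)
    (hsq : ∀ v, 0 < v → η1 v ^ 2 ≤ c * η2 v) (hL : ∀ i x, |pd i χ x| ≤ L) {t : ℝ} (ht : 0 ≤ t) :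
    (1 - ε) * Wis S (fun x => χ x * χ x) (fun _ => 0) η2 t ≤
      - Dis S (fun x => χ x * χ x) (fun _ => 0) η1 t + c / ε * (n * L ^ 2) := by
  have hψ := Cut.sq h1 h2
  have hr := RA.zero S
  have hχ1 : ContDiff ℝ 1 χ := h1.of_le (by norm_num)
  rw [D_eq1 hψ hη hr ht]
  have hz : ∀ x, Aop S.ν (fun _ => (0 : ℝ)) x = 0 := by
    intro x; simp [Aop, pd]
  simp only [hz, mul_zero, integral_zero, add_zero]
  have hW := W_int hψ hη hr ht
  have hci : Integrable (fun x => S.ν x * (η1 (S.u t x - 0) *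
      ∑ i, pd i (fun x => χ x * χ x) x * pd i (fun y => S.u t y - 0) x)) := by
    refine Continuous.integrable_of_hasCompactSupport ?_ ?_
    · refine S.νC.continuous.mul ((comp_cd hη.C1 hr hη.opn ht).continuous.mul ?_)
      exact continuous_finsetSum _ fun i _ =>
        (pd_cont (hψ.C.of_le (by norm_num)) i).mul (pd_cont ((v_cd hr ht).of_le (by norm_num)) i)
    · refine HasCompactSupport.mul_left (HasCompactSupport.mul_left ?_)
      have e : (fun x => ∑ i, pd i (fun x => χ x * χ x) x * pd i (fun y => S.u t y - 0) x) =
          fun x => χ x * ∑ i, 2 * pd i χ x * pd i (fun y => S.u t y - 0) x := by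
        ext x
        rw [Finset.mul_sum]
        refine Finset.sum_congr rfl fun i _ => ?_
        rw [pd_mul hχ1 hχ1]; ring
      rw [e]
      exact h2.mul_right
  have key : -(ε * Wis S (fun x => χ x * χ x) (fun _ => 0) η2 t) - c / ε * (n * L ^ 2) ≤
      ∫ x, S.ν x * (η1 (S.u t x - 0) *
        ∑ i, pd i (fun x => χ x * χ x) x * pd i (fun y => S.u t y - 0) x) := by
    have e : -(ε * Wis S (fun x => χ x * χ x) (fun _ => 0) η2 t) - c / ε * (n * L ^ 2) =
        ∫ x, (-(ε * (S.ν x * (χ x * χ x * η2 (S.u t x - 0) *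
          ∑ i, pd i (fun y => S.u t y - 0) x ^ 2))) - c / ε * (n * L ^ 2) * S.ν x) := by
      rw [integral_sub (hW.const_mul ε).fun_neg (S.νint.const_mul _), integral_neg,
        integral_const_mul, integral_const_mul, S.νmass, mul_one]
      rfl
    rw [e]
    refine integral_mono ((hW.const_mul ε).neg.sub (S.νint.const_mul _)) hci fun x => ?_
    simp only
    have hu : 0 < S.u t x - 0 := hr.mem t ht x
    have hs := hsq _ hu
    set a := η1 (S.u t x - 0)
    set d := η2 (S.u t x - 0)
    have hi : ∀ i, -(ε * (χ x * χ x * d * pd i (fun y => S.u t y - 0) x ^ 2)) - c / ε * L ^ 2 ≤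
        a * (pd i (fun x => χ x * χ x) x * pd i (fun y => S.u t y - 0) x) := by
      intro i
      rw [pd_mul hχ1 hχ1]
      have hp : pd i χ x ^ 2 ≤ L ^ 2 := by
        rw [← sq_abs]; exact pow_le_pow_left₀ (abs_nonneg _) (hL i x) 2
      set p := pd i χ x
      set q := pd i (fun y => S.u t y - 0) x
      set y := χ x
      have h3 : 0 ≤ (ε / c) * (y * a * q + (c / ε) * p) ^ 2 := by positivity
      have h4 : (ε / c) * (y * a * q + (c / ε) * p) ^ 2 =
          (ε / c) * (y ^ 2 * a ^ 2 * q ^ 2) + 2 * (y * a * q * p) + c / ε * p ^ 2 := by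
        field_simp; ring
      have h5 : (ε / c) * (y ^ 2 * a ^ 2 * q ^ 2) ≤ (ε / c) * (y ^ 2 * (c * d) * q ^ 2) := by
        gcongr
      have h6 : (ε / c) * (y ^ 2 * (c * d) * q ^ 2) = ε * (y * y * d * q ^ 2) := by
        field_simp
      have h7 : c / ε * p ^ 2 ≤ c / ε * L ^ 2 := by gcongr
      nlinarith
    have hsum := Finset.sum_le_sum fun i (_ : i ∈ Finset.univ) => hi i
    simp only [Finset.sum_sub_distrib, Finset.sum_neg_distrib, ← Finset.mul_sum,
      Finset.sum_const, Finset.card_univ, Fintype.card_fin, nsmul_eq_mul] at hsum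
    have := mul_le_mul_of_nonneg_left hsum (S.νpos x).le
    linarith
  linarith

end
end FPE

namespace FPE
open Set Filter Topology

theorem fat {μ : Measure ℝ} {G : ℕ → ℝ → ENNReal} (hG : ∀ m, Measurable (G m)) {B : ℕ → ℝ} {b : ℝ}
    (hB : ∀ m, ∫⁻ τ, G m τ ∂μ ≤ ENNReal.ofReal (B m)) (hb : Tendsto B atTop (𝓝 b)) :
    ∫⁻ τ, liminf (fun m => G m τ) atTop ∂μ ≤ ENNReal.ofReal b := by
  refine (lintegral_liminf_le hG).trans ?_
  have h : Tendsto (fun m => ENNReal.ofReal (B m)) atTop (𝓝 (ENNReal.ofReal b)) :=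
    (ENNReal.continuous_ofReal.tendsto b).comp hb
  rw [← h.liminf_eq]
  exact liminf_le_liminf (Eventually.of_forall hB)

section
variable {n : ℕ} {S : Sys n}

/-- the weighted dissipation without cutoff -/
noncomputable def Inf (S : Sys n) (η2 : ℝ → ℝ) (t : ℝ) : ℝ :=
  ∫ x, S.ν x * (η2 (S.u t x) * ∑ i, pd i (S.u t) x ^ 2)

theorem step_m {η η1 η2 : ℝ → ℝ} {B c : ℝ} (hη : Adm (Ioi 0) η η1 η2 B) (hc : 0 < c)
    (hsq : ∀ v, 0 < v → η1 v ^ 2 ≤ c * η2 v)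
    (hI : ∀ t, 0 ≤ t → Integrable (fun x => S.ν x * (η2 (S.u t x) * ∑ i, pd i (S.u t) x ^ 2)))
    {s t : ℝ} (hs : 0 ≤ s) (hst : s ≤ t) :
    ∃ J : ℝ → ENNReal, Measurable J ∧ (∀ τ, 0 ≤ τ → ENNReal.ofReal (Inf S η2 τ) ≤ J τ) ∧
      ∫⁻ τ in Ioc s t, J τ ≤
        ENNReal.ofReal ((∫ x, η (S.u s x) * S.ν x) - ∫ x, η (S.u t x) * S.ν x) ∧
      0 ≤ (∫ x, η (S.u s x) * S.ν x) - ∫ x, η (S.u t x) * S.ν x := by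
  obtain ⟨χ, C, hχ1, hχ2, hχ0, hχle, hχt, hχd⟩ := cutoffs n
  have hr := RA.zero S
  have hψ : ∀ m, Cut (fun x => χ m x * χ m x) := fun m => Cut.sq (hχ1 m) (hχ2 m)
  set D : ℕ → ℝ → ℝ := fun m τ => Dis S (fun x => χ m x * χ m x) (fun _ => 0) η1 τ with hD
  set F : ℕ → ℝ → ℝ := fun m τ => Fun S (fun x => χ m x * χ m x) (fun _ => 0) η τ with hF
  set W : ℕ → ℝ → ℝ := fun m τ => Wis S (fun x => χ m x * χ m x) (fun _ => 0) η2 τ with hW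
  set e : ℕ → ℝ := fun m => c * n * C ^ 2 * (1 / ((m : ℝ) + 1)) with he
  have he0 : Tendsto e atTop (𝓝 0) := by
    have := (tendsto_one_div_add_atTop_nhds_zero_nat (𝕜 := ℝ)).const_mul (c * n * C ^ 2)
    simpa [he] using this
  have hεt : Tendsto (fun m : ℕ => 1 - 1 / ((m : ℝ) + 1)) atTop (𝓝 1) := by
    have := (tendsto_one_div_add_atTop_nhds_zero_nat (𝕜 := ℝ)).const_sub 1
    simpa using this
  have hineq : ∀ (m : ℕ) (τ : ℝ), 0 ≤ τ → (1 - 1 / ((m : ℝ) + 1)) * W m τ ≤ - D m τ + e m := by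
    intro m τ hτ
    have hm : (0 : ℝ) < (m : ℝ) + 1 := by positivity
    have h := cut_ineq (S := S) (hχ1 m) (hχ2 m) hη hc (show 0 < 1 / ((m : ℝ) + 1) by positivity) hsq
      (hχd m) hτ
    refine h.trans (le_of_eq ?_)
    simp only [hD, he]
    congr 1
    field_simp
  have hpos : ∀ (m : ℕ) (τ : ℝ), 0 ≤ τ → 0 ≤ - D m τ + e m := by
    intro m τ hτ
    refine le_trans (mul_nonneg ?_ (W_nonneg (hψ m) hη hr hτ)) (hineq m τ hτ)
    have : 1 / ((m : ℝ) + 1) ≤ 1 := by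
      rw [div_le_one (by positivity)]
      have : (0 : ℝ) ≤ m := Nat.cast_nonneg m
      linarith
    linarith
  set G : ℕ → ℝ → ENNReal := fun m τ => ENNReal.ofReal (- D m (max τ 0) + e m) with hG
  have hGm : ∀ m, Measurable (G m) := by
    intro m
    have h := (integrand_meas (hψ m) hη hr).stronglyMeasurable.integral_prod_right' (ν := volume)
    exact (h.measurable.neg.add_const (e m)).ennreal_ofReal
  have hId : ∀ m, IntervalIntegrable (D m) volume s t ∧ F m t - F m s = ∫ τ in s..t, D m τ :=
    fun m => idn_all (hψ m) hs hst _ _ _ _ _ _ hη hr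
  have hbint : ∀ m, ∫ τ in Ioc s t, (- D m τ + e m) = F m s - F m t + e m * (t - s) := by
    intro m
    have hn : IntervalIntegrable (fun τ => - D m τ) volume s t := (hId m).1.neg
    rw [← intervalIntegral.integral_of_le hst, intervalIntegral.integral_add hn
      intervalIntegrable_const, intervalIntegral.integral_neg, ← (hId m).2]
    simp; ring
  have hint : ∀ m, IntegrableOn (fun τ => - D m τ + e m) (Ioc s t) := fun m =>
    (intervalIntegrable_iff_integrableOn_Ioc_of_le hst).1 ((hId m).1.neg.add intervalIntegrable_const)
  have hGle : ∀ m, ∫⁻ τ in Ioc s t, G m τ ≤ ENNReal.ofReal (F m s - F m t + e m * (t - s)) := by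
    intro m
    rw [← hbint m, ofReal_integral_eq_lintegral_ofReal (hint m)]
    · refine le_of_eq (setLIntegral_congr_fun measurableSet_Ioc fun τ hτ => ?_)
      simp only [hG, max_eq_left (hs.trans hτ.1.le)]
    · filter_upwards [ae_restrict_mem measurableSet_Ioc] with τ hτ
      exact hpos m τ (hs.trans hτ.1.le)
  have hFt : ∀ τ, 0 ≤ τ → Tendsto (fun m => F m τ) atTop (𝓝 (∫ x, η (S.u τ x) * S.ν x)) := by
    intro τ hτ
    have hb := eta_int hη hr hτ
    refine tendsto_integral_of_dominated_convergence _ (fun m => ?_) hb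
      (fun m => Eventually.of_forall fun x => ?_) (Eventually.of_forall fun x => ?_)
    · exact (F_int (hψ m) hη hr hτ).aestronglyMeasurable
    · have h1 : χ m x * χ m x ≤ 1 := by nlinarith [hχ0 m x, hχle m x]
      rw [norm_mul, norm_mul, Real.norm_of_nonneg (mul_self_nonneg _),
        Real.norm_of_nonneg (S.νpos x).le, Real.norm_eq_abs]
      have := mul_le_mul_of_nonneg_right h1 (mul_nonneg (S.νpos x).le (abs_nonneg (η (S.u τ x - 0))))
      linarith
    · have h1 := ((((hχt x).mul (hχt x)).mul_const (S.ν x)).mul_const (η (S.u τ x - 0)))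
      have e1 : η (S.u τ x) * S.ν x = 1 * 1 * S.ν x * η (S.u τ x - 0) := by rw [sub_zero]; ring
      rw [e1]; exact h1
  have hWt : ∀ τ, 0 ≤ τ → Tendsto (fun m => W m τ) atTop (𝓝 (Inf S η2 τ)) := by
    intro τ hτ
    refine tendsto_integral_of_dominated_convergence _ (fun m => ?_) (hI τ hτ)
      (fun m => Eventually.of_forall fun x => ?_) (Eventually.of_forall fun x => ?_)
    · exact (W_int (hψ m) hη hr hτ).aestronglyMeasurable
    · have h1 : χ m x * χ m x ≤ 1 := by nlinarith [hχ0 m x, hχle m x]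
      simp only [sub_zero]
      have h2 : 0 ≤ η2 (S.u τ x) := hη.pos _ (S.upos τ hτ x)
      have h3 : 0 ≤ ∑ i, pd i (S.u τ) x ^ 2 := Finset.sum_nonneg fun i _ => sq_nonneg _
      have h4 := (S.νpos x).le
      have h0 := mul_self_nonneg (χ m x)
      change ‖S.ν x * (χ m x * χ m x * η2 (S.u τ x) * ∑ i, pd i (S.u τ) x ^ 2)‖ ≤ _
      rw [Real.norm_of_nonneg (by positivity)]
      have := mul_le_mul_of_nonneg_right h1 (mul_nonneg h4 (mul_nonneg h2 h3))
      linarith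
    · simp only [sub_zero]
      have h1 := (((hχt x).mul (hχt x)).mul_const (η2 (S.u τ x))).mul_const
        (∑ i, pd i (S.u τ) x ^ 2) |>.const_mul (S.ν x)
      simpa using h1
  have hbt : Tendsto (fun m => F m s - F m t + e m * (t - s)) atTop
      (𝓝 ((∫ x, η (S.u s x) * S.ν x) - ∫ x, η (S.u t x) * S.ν x)) := by
    have := ((hFt s hs).sub (hFt t (hs.trans hst))).add (he0.mul_const (t - s))
    simpa using this
  refine ⟨fun τ => liminf (fun m => G m τ) atTop, Measurable.liminf hGm, fun τ hτ => ?_,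
    fat hGm hGle hbt, ?_⟩
  · have h1 : Tendsto (fun m : ℕ => ENNReal.ofReal ((1 - 1 / ((m : ℝ) + 1)) * W m τ)) atTop
        (𝓝 (ENNReal.ofReal (Inf S η2 τ))) := by
      have := hεt.mul (hWt τ hτ)
      rw [one_mul] at this
      exact (ENNReal.continuous_ofReal.tendsto _).comp this
    rw [← h1.liminf_eq]
    refine liminf_le_liminf (Eventually.of_forall fun m => ?_)
    simp only [hG, max_eq_left hτ]
    exact ENNReal.ofReal_le_ofReal (hineq m τ hτ)
  · refine ge_of_tendsto' hbt fun m => ?_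
    rw [← hbint m]
    refine setIntegral_nonneg measurableSet_Ioc fun τ hτ => hpos m τ (hs.trans hτ.1.le)

end
end FPE

namespace FPE
open Set Filter Topology

/-- the normalized regularized entropy -/
noncomputable def Ent (δ k v : ℝ) : ℝ :=
  (v + δ) * log (v + δ) - (v + k) * log (v + k) + (log k + 1) * v + k * log k

theorem Ent_eq {δ k v : ℝ} (hk : 0 < k) (hv : 0 < v) :
    Ent δ k v = (v + δ) * log (v + δ) + v - (v + k) * log (1 + v / k) := by
  have h : v + k = k * (1 + v / k) := by field_simp; ring
  have h1 : (0 : ℝ) < 1 + v / k := by positivity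
  have h2 : log (v + k) = log k + log (1 + v / k) := by
    rw [h, Real.log_mul hk.ne' h1.ne']
  unfold Ent
  rw [h2]; ring

theorem log1p_le {y : ℝ} (hy : 0 < y) : log (1 + y) ≤ y := by
  have := Real.log_le_sub_one_of_pos (show 0 < 1 + y by linarith)
  linarith

theorem xlog_ge {w : ℝ} (hw : 0 < w) : w - 1 ≤ w * log w := by
  have h := Real.log_le_sub_one_of_pos (inv_pos.2 hw)
  rw [Real.log_inv] at h
  have := mul_le_mul_of_nonneg_left h hw.le
  have e : w * (w⁻¹ - 1) = 1 - w := by field_simp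
  rw [e] at this
  linarith

theorem Ent_lower {δ k v : ℝ} (hk : 0 < k) (hv : 0 < v) :
    (v + δ) * log (v + δ) - v * log (1 + v / k) ≤ Ent δ k v := by
  rw [Ent_eq hk hv]
  have h := mul_le_mul_of_nonneg_left (log1p_le (div_pos hv hk)) hk.le
  have e : k * (v / k) = v := by field_simp
  rw [e] at h
  linarith

theorem Ent_upper {δ k v : ℝ} (hδ : 0 < δ) (hk : 0 < k) (hv : 0 < v) :
    Ent δ k v ≤ v * log v + δ * (v + δ) := by
  rw [Ent_eq hk hv]
  have h1 : v ≤ (v + k) * log (1 + v / k) := by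
    have hp : 0 < 1 + v / k := by positivity
    have h := xlog_ge hp
    have := mul_le_mul_of_nonneg_left h hk.le
    have e1 : k * (1 + v / k - 1) = v := by field_simp; ring
    have e2 : k * ((1 + v / k) * log (1 + v / k)) = (v + k) * log (1 + v / k) := by
      field_simp; ring
    rw [e1, e2] at this
    exact this
  have h2 : log (v + δ) = log v + log (1 + δ / v) := by
    rw [← Real.log_mul hv.ne' (by positivity)]
    congr 1; field_simp
  have h3 : v * log (1 + δ / v) ≤ δ := by
    have h := mul_le_mul_of_nonneg_left (log1p_le (div_pos hδ hv)) hv.le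
    have e : v * (δ / v) = δ := by field_simp
    rwa [e] at h
  have h4 : δ * log (v + δ) ≤ δ * (v + δ - 1) :=
    mul_le_mul_of_nonneg_left (Real.log_le_sub_one_of_pos (by linarith)) hδ.le
  have h5 : v * log (v + δ) = v * log v + v * log (1 + δ / v) := by rw [h2]; ring
  linarith

theorem Ent_ge {δ k v : ℝ} (hk : 1 ≤ k) (hδ : δ = 1 / k) (hv : 0 < v) : -2 ≤ Ent δ k v := by
  have hk0 : 0 < k := by linarith
  have hδ0 : 0 < δ := by rw [hδ]; positivity
  have hd1 : δ ≤ 1 := by rw [hδ, div_le_one hk0]; exact hk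
  refine le_trans ?_ (Ent_lower hk0 hv)
  have e : v / k = v * δ := by rw [hδ]; ring
  rw [e]
  rcases le_total 1 v with h | h
  · have h1 : log (1 + v * δ) ≤ log (v + δ) := by
      apply Real.log_le_log (by positivity)
      nlinarith
    have h2 : 0 ≤ log (v + δ) := Real.log_nonneg (by linarith)
    nlinarith [mul_nonneg hδ0.le h2, mul_le_mul_of_nonneg_left h1 hv.le]
  · have h1 := xlog_ge (show 0 < v + δ by linarith)
    have h2 := mul_le_mul_of_nonneg_left (log1p_le (mul_pos hv hδ0)) hv.le
    have h3 : v * (v * δ) ≤ 1 := by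
      have : v * δ ≤ 1 := by nlinarith
      nlinarith
    linarith

theorem Ent_abs {δ k v : ℝ} (hk : 1 ≤ k) (hδ : δ = 1 / k) (hv : 0 < v) :
    |Ent δ k v| ≤ |v * log v| + v + 3 := by
  have hk0 : 0 < k := by linarith
  have hδ0 : 0 < δ := by rw [hδ]; positivity
  have hd1 : δ ≤ 1 := by rw [hδ, div_le_one hk0]; exact hk
  rw [abs_le]
  constructor
  · have := Ent_ge hk hδ hv
    have := abs_nonneg (v * log v)
    linarith
  · have := Ent_upper hδ0 hk0 hv
    have := le_abs_self (v * log v)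
    nlinarith

/-- the cutoff levels -/
noncomputable def kk (j : ℕ) : ℝ := (j : ℝ) + 2

theorem kk_ge (j : ℕ) : 2 ≤ kk j := by
  unfold kk; have : (0 : ℝ) ≤ j := Nat.cast_nonneg j
  linarith

theorem kk_top : Tendsto kk atTop atTop :=
  tendsto_atTop_add_const_right _ _ tendsto_natCast_atTop_atTop

theorem dd_zero : Tendsto (fun j => 1 / kk j) atTop (𝓝 0) := by
  simp only [one_div]
  exact kk_top.inv_tendsto_atTop

theorem Ent_tendsto {v : ℝ} (hv : 0 < v) :
    Tendsto (fun j => Ent (1 / kk j) (kk j) v) atTop (𝓝 (v * log v)) := by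
  have hvd : Tendsto (fun j => v + 1 / kk j) atTop (𝓝 v) := by simpa using dd_zero.const_add v
  have hl : Tendsto (fun j => log (v + 1 / kk j)) atTop (𝓝 (log v)) :=
    (Real.continuousAt_log hv.ne').tendsto.comp hvd
  have h1 : Tendsto (fun j => 1 + v / kk j) atTop (𝓝 1) := by
    have := (dd_zero.const_mul v).const_add 1
    simpa [div_eq_mul_inv] using this
  have hl1 : Tendsto (fun j => log (1 + v / kk j)) atTop (𝓝 0) := by
    have := (Real.continuousAt_log one_ne_zero).tendsto.comp h1
    rw [Real.log_one] at this
    exact this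
  refine tendsto_of_tendsto_of_tendsto_of_le_of_le
    (g := fun j => (v + 1 / kk j) * log (v + 1 / kk j) - v * log (1 + v / kk j))
    (h := fun j => v * log v + 1 / kk j * (v + 1 / kk j)) ?_ ?_ ?_ ?_
  · simpa using (hvd.mul hl).sub (hl1.const_mul v)
  · simpa using (dd_zero.mul hvd).const_add (v * log v)
  · intro j
    have := kk_ge j
    exact Ent_lower (by linarith) hv
  · intro j
    have := kk_ge j
    have : 0 < kk j := by linarith
    exact Ent_upper (by positivity) this hv

section
variable {n : ℕ} {S : Sys n}

/-- relative entropy -/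
noncomputable def HH (S : Sys n) (t : ℝ) : ℝ := ∫ x, S.u t x * log (S.u t x) * S.ν x

theorem eta_int' {η η1 η2 : ℝ → ℝ} {B : ℝ} (hη : Adm (Ioi 0) η η1 η2 B) {t : ℝ} (ht : 0 ≤ t) :
    Integrable (fun x => η (S.u t x) * S.ν x) := by
  refine (eta_int hη (RA.zero S) ht).mono' ?_ (Eventually.of_forall fun x => ?_)
  · have h : Continuous (fun x => η (S.u t x)) :=
      (hη.C1'.continuousOn).comp_continuous (S.uC t ht).continuous (fun x => S.upos t ht x)
    exact (h.mul S.νC.continuous).aestronglyMeasurable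
  · rw [norm_mul, Real.norm_of_nonneg (S.νpos x).le, Real.norm_eq_abs, sub_zero, mul_comm]

theorem step_j
    (hFI : ∀ t, 0 ≤ t → Integrable (fun x => S.ν x * ((S.u t x)⁻¹ * ∑ i, pd i (S.u t) x ^ 2)))
    (hH : ∀ t, 0 ≤ t → Integrable (fun x => S.u t x * log (S.u t x) * S.ν x))
    {s t : ℝ} (hs : 0 ≤ s) (hst : s ≤ t) :
    ∫⁻ τ in Ioc s t, ENNReal.ofReal (Inf S (fun v => v⁻¹) τ) ≤ ENNReal.ofReal (HH S s - HH S t) ∧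
      0 ≤ HH S s - HH S t := by
  set η : ℕ → ℝ → ℝ := fun j v => (v + 1 / kk j) * log (v + 1 / kk j) - (v + kk j) * log (v + kk j)
    with hηd
  set η2 : ℕ → ℝ → ℝ := fun j v => (kk j - 1 / kk j) / ((v + 1 / kk j) * (v + kk j)) with hetaDef
  have hk0 : ∀ j, 0 < kk j := fun j => by have := kk_ge j; linarith
  have hd0 : ∀ j, 0 < 1 / kk j := fun j => by have := hk0 j; positivity
  have hdk : ∀ j, 1 / kk j < kk j := fun j => by
    have := kk_ge j
    have : 1 / kk j ≤ 1 := by rw [div_le_one (hk0 j)]; linarith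
    linarith
  have hadm := fun j => adm_log (hd0 j) (hdk j)
  have hetaLe : ∀ j v, 0 < v → η2 j v ≤ v⁻¹ := by
    intro j v hv
    have h1 := hk0 j
    have h2 := hd0 j
    simp only [hetaDef]
    rw [← one_div, div_le_div_iff₀ (by positivity) hv]
    nlinarith [mul_pos hv hv, mul_pos hv h2, mul_pos h2 h1]
  have hetaTend : ∀ v, 0 < v → Tendsto (fun j => η2 j v) atTop (𝓝 v⁻¹) := by
    intro v hv
    have e : (fun j => η2 j v) = fun j => (v + 1 / kk j)⁻¹ - (v + kk j)⁻¹ := by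
      ext j
      have h1 := hk0 j
      have h2 := hd0 j
      simp only [hetaDef]
      have h3 : v + 1 / kk j ≠ 0 := by positivity
      have h4 : v + kk j ≠ 0 := by positivity
      rw [inv_sub_inv h3 h4]
      congr 1; ring
    rw [e]
    have a1 : Tendsto (fun j => v + 1 / kk j) atTop (𝓝 v) := by simpa using dd_zero.const_add v
    have a2 : Tendsto (fun j => (v + kk j)⁻¹) atTop (𝓝 0) :=
      (tendsto_atTop_add_const_left _ v kk_top).inv_tendsto_atTop
    simpa using (a1.inv₀ hv.ne').sub a2
  have hsum : ∀ τ x, 0 ≤ ∑ i, pd i (S.u τ) x ^ 2 :=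
    fun τ x => Finset.sum_nonneg fun i _ => sq_nonneg _
  have hm : ∀ j τ, 0 ≤ τ → AEStronglyMeasurable
      (fun x => S.ν x * (η2 j (S.u τ x) * ∑ i, pd i (S.u τ) x ^ 2)) := by
    intro j τ hτ
    have h1 : Continuous (fun x => η2 j (S.u τ x)) :=
      (hadm j).c2.comp_continuous (S.uC τ hτ).continuous (fun x => S.upos τ hτ x)
    have h2 : Continuous (fun x => ∑ i, pd i (S.u τ) x ^ 2) :=
      continuous_finsetSum _ fun i _ => (pd_cont ((S.uC τ hτ).of_le (by norm_num)) i).pow 2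
    exact (S.νC.continuous.mul (h1.mul h2)).aestronglyMeasurable
  have hbd : ∀ j τ, 0 ≤ τ → ∀ x, ‖S.ν x * (η2 j (S.u τ x) * ∑ i, pd i (S.u τ) x ^ 2)‖ ≤
      S.ν x * ((S.u τ x)⁻¹ * ∑ i, pd i (S.u τ) x ^ 2) := by
    intro j τ hτ x
    have h0 := hsum τ x
    have h1 := (S.νpos x).le
    have h2 : 0 ≤ η2 j (S.u τ x) := (hadm j).pos _ (S.upos τ hτ x)
    rw [Real.norm_of_nonneg (by positivity)]
    exact mul_le_mul_of_nonneg_left (mul_le_mul_of_nonneg_right (hetaLe j _ (S.upos τ hτ x)) h0) h1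
  have hI : ∀ j τ, 0 ≤ τ →
      Integrable (fun x => S.ν x * (η2 j (S.u τ x) * ∑ i, pd i (S.u τ) x ^ 2)) := fun j τ hτ =>
    (hFI τ hτ).mono' (hm j τ hτ) (Eventually.of_forall (hbd j τ hτ))
  have hstep : ∀ j, _ := fun j => step_m (S := S) (hadm j)
    (show 0 < (kk j - 1 / kk j) * kk j / (1 / kk j) from
      div_pos (mul_pos (sub_pos.2 (hdk j)) (hk0 j)) (hd0 j))
    (fun v hv => adm_log_sq (hd0 j) (hdk j) hv) (hI j) hs hst
  choose J hJm hJ hJi hJ0 using hstep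
  have hInft : ∀ τ, 0 ≤ τ → Tendsto (fun j => Inf S (η2 j) τ) atTop (𝓝 (Inf S (fun v => v⁻¹) τ)) := by
    intro τ hτ
    refine tendsto_integral_of_dominated_convergence _ (fun j => hm j τ hτ) (hFI τ hτ)
      (fun j => Eventually.of_forall (hbd j τ hτ)) (Eventually.of_forall fun x => ?_)
    exact ((hetaTend _ (S.upos τ hτ x)).mul_const _).const_mul _
  have hEeq : ∀ j τ, 0 ≤ τ → ∫ x, Ent (1 / kk j) (kk j) (S.u τ x) * S.ν x =
      (∫ x, η j (S.u τ x) * S.ν x) + (log (kk j) + 1) + kk j * log (kk j) := by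
    intro j τ hτ
    have h1 : (fun x => Ent (1 / kk j) (kk j) (S.u τ x) * S.ν x) = fun x =>
        (η j (S.u τ x) * S.ν x + (log (kk j) + 1) * (S.u τ x * S.ν x)) +
          (kk j * log (kk j)) * S.ν x := by
      ext x; simp only [Ent, hηd]; ring
    have i1 : Integrable (fun x => η j (S.u τ x) * S.ν x) := eta_int' (hadm j) hτ
    have i2 := (S.uint τ hτ).const_mul (log (kk j) + 1)
    have i3 := S.νint.const_mul (kk j * log (kk j))
    have i12 : Integrable (fun x => η j (S.u τ x) * S.ν x + (log (kk j) + 1) * (S.u τ x * S.ν x)) :=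
      i1.add i2
    rw [h1, integral_add i12 i3, integral_add i1 i2, integral_const_mul, integral_const_mul,
      S.umass τ hτ, S.νmass]
    ring
  have hEt : ∀ τ, 0 ≤ τ → Tendsto (fun j => ∫ x, Ent (1 / kk j) (kk j) (S.u τ x) * S.ν x) atTop
      (𝓝 (HH S τ)) := by
    intro τ hτ
    have hb : Integrable (fun x => |S.u τ x * log (S.u τ x) * S.ν x| + S.u τ x * S.ν x + 3 * S.ν x) :=
      ((hH τ hτ).abs.add (S.uint τ hτ)).add (S.νint.const_mul 3)
    refine tendsto_integral_of_dominated_convergence _ (fun j => ?_) hb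
      (fun j => Eventually.of_forall fun x => ?_) (Eventually.of_forall fun x => ?_)
    · have h : Continuous (fun x => η j (S.u τ x)) :=
        ((hadm j).C1'.continuousOn).comp_continuous (S.uC τ hτ).continuous (fun x => S.upos τ hτ x)
      have hu := (S.uC τ hτ).continuous
      have : Continuous (fun x => (η j (S.u τ x) + (log (kk j) + 1) * S.u τ x + kk j * log (kk j))
        * S.ν x) := by
        have := S.νC.continuous
        fun_prop
      exact this.aestronglyMeasurable
    · have hν := (S.νpos x).le
      rw [norm_mul, Real.norm_of_nonneg hν, Real.norm_eq_abs, abs_mul _ (S.ν x), abs_of_nonneg hν]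
      have := mul_le_mul_of_nonneg_right
        (Ent_abs (by have := kk_ge j; linarith) rfl (S.upos τ hτ x) (k := kk j)) hν
      linarith
    · exact (Ent_tendsto (S.upos τ hτ x)).mul_const _
  have hbt : Tendsto (fun j => (∫ x, η j (S.u s x) * S.ν x) - ∫ x, η j (S.u t x) * S.ν x) atTop
      (𝓝 (HH S s - HH S t)) := by
    refine ((hEt s hs).sub (hEt t (hs.trans hst))).congr fun j => ?_
    rw [hEeq j s hs, hEeq j t (hs.trans hst)]; ring
  refine ⟨le_trans ?_ (fat hJm hJi hbt), ge_of_tendsto' hbt hJ0⟩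
  refine setLIntegral_mono' measurableSet_Ioc fun τ hτ => ?_
  have hτ0 : 0 ≤ τ := hs.trans hτ.1.le
  have h1 : Tendsto (fun j => ENNReal.ofReal (Inf S (η2 j) τ)) atTop
      (𝓝 (ENNReal.ofReal (Inf S (fun v => v⁻¹) τ))) :=
    (ENNReal.continuous_ofReal.tendsto _).comp (hInft τ hτ0)
  rw [← h1.liminf_eq]
  exact liminf_le_liminf (Eventually.of_forall fun j => hJ j τ hτ0)

end
end FPE

namespace FPE
open Set Filter Topology

theorem int_of_mass {X : Type*} [MeasurableSpace X] {μ : Measure X} {g : X → ℝ}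
    (h : ∫ x, g x ∂μ = 1) : Integrable g μ := by
  by_contra hc
  rw [integral_undef hc] at h
  exact zero_ne_one h

theorem grad_apply {n : ℕ} (g : EuclideanSpace ℝ (Fin n) → ℝ) (y : EuclideanSpace ℝ (Fin n))
    (i : Fin n) : gradient g y i = pd i g y := by
  have h : inner ℝ (gradient g y) (EuclideanSpace.single i (1 : ℝ)) = pd i g y := by
    unfold gradient pd
    rw [InnerProductSpace.toDual_symm_apply]
  rw [← h, EuclideanSpace.inner_single_right]
  simp

theorem decay {H : ℝ → ℝ} {a : ℝ} (ha : 0 < a)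
    (h : ∀ s t, 0 ≤ s → s ≤ t → (1 + a * (t - s)) * H t ≤ H s) {t : ℝ} (ht : 0 ≤ t) :
    H t ≤ exp (- (a * t)) * H 0 := by
  have key : ∀ m : ℕ, 0 < m → (1 + a * t / m) ^ m * H t ≤ H 0 := by
    intro m hm
    have hm' : (0 : ℝ) < m := by exact_mod_cast hm
    have hs : ∀ j : ℕ, (1 + a * t / m) ^ j * H (j * (t / m)) ≤ H 0 := by
      intro j
      induction j with
      | zero => simp
      | succ j ih =>
        refine le_trans ?_ ih
        have h1 := h (j * (t / m)) ((j + 1 : ℕ) * (t / m)) (by positivity)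
          (mul_le_mul_of_nonneg_right (by push_cast; linarith) (by positivity))
        have e : 1 + a * (((j + 1 : ℕ) : ℝ) * (t / m) - j * (t / m)) = 1 + a * t / m := by
          push_cast; ring
        rw [e] at h1
        rw [pow_succ, mul_assoc]
        exact mul_le_mul_of_nonneg_left h1 (by positivity)
    have := hs m
    rwa [mul_div_cancel₀ t hm'.ne'] at this
  have hlim := (Real.tendsto_one_add_div_pow_exp (a * t)).mul_const (H t)
  have hle : exp (a * t) * H t ≤ H 0 := by
    refine le_of_tendsto hlim ?_
    filter_upwards [eventually_gt_atTop 0] with m hm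
    exact key m hm
  have := mul_le_mul_of_nonneg_left hle (exp_pos (- (a * t))).le
  rwa [← mul_assoc, ← Real.exp_add, neg_add_cancel, Real.exp_zero, one_mul] at this

section
variable {n : ℕ} {S : Sys n}

theorem HH_nonneg (hH : ∀ t, 0 ≤ t → Integrable (fun x => S.u t x * log (S.u t x) * S.ν x))
    {t : ℝ} (ht : 0 ≤ t) : 0 ≤ HH S t := by
  have h : ∫ x, (S.u t x * S.ν x - S.ν x) ≤ HH S t := by
    refine integral_mono ((S.uint t ht).sub S.νint) (hH t ht) fun x => ?_
    have := mul_le_mul_of_nonneg_right (xlog_ge (S.upos t ht x)) (S.νpos x).le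
    simp only
    linarith
  rw [integral_sub (S.uint t ht) S.νint, S.umass t ht, S.νmass] at h
  linarith

theorem main
    (hFI : ∀ t, 0 ≤ t → Integrable (fun x => S.ν x * ((S.u t x)⁻¹ * ∑ i, pd i (S.u t) x ^ 2)))
    (hH : ∀ t, 0 ≤ t → Integrable (fun x => S.u t x * log (S.u t x) * S.ν x))
    {a : ℝ} (ha : 0 < a) (hL : ∀ t, 0 ≤ t → a * HH S t ≤ Inf S (fun v => v⁻¹) t)
    {t : ℝ} (ht : 0 ≤ t) : HH S t ≤ exp (- (a * t)) * HH S 0 := by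
  refine decay ha (fun s t hs hst => ?_) ht
  obtain ⟨h1, h2⟩ := step_j hFI hH hs hst
  have h3 : ENNReal.ofReal (a * HH S t * (t - s)) ≤ ENNReal.ofReal (HH S s - HH S t) := by
    refine le_trans ?_ h1
    have hc : ∫⁻ _ in Ioc s t, ENNReal.ofReal (a * HH S t) = ENNReal.ofReal (a * HH S t * (t - s)) := by
      rw [setLIntegral_const, Real.volume_Ioc, ← ENNReal.ofReal_mul]
      exact mul_nonneg ha.le (HH_nonneg hH (hs.trans hst))
    rw [← hc]
    refine setLIntegral_mono' measurableSet_Ioc fun τ hτ => ENNReal.ofReal_le_ofReal ?_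
    have hτ0 : 0 ≤ τ := hs.trans hτ.1.le
    refine le_trans ?_ (hL τ hτ0)
    have := (step_j hFI hH hτ0 hτ.2).2
    exact mul_le_mul_of_nonneg_left (by linarith) ha.le
  have h4 := (ENNReal.ofReal_le_ofReal_iff h2).1 h3
  linarith

end

section
variable {n : ℕ} {f : EuclideanSpace ℝ (Fin n) → ℝ} {r : EuclideanSpace ℝ (Fin n) → ℝ}

theorem flux_eq (hf : ContDiff ℝ 2 f) (hr : ContDiff ℝ 2 r) (i : Fin n) (y) :
    exp (-f y) * pd i (fun x => r x * exp (f x)) y = (r y • gradient f y + gradient r y) i := by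
  have hf1 : ContDiff ℝ 1 f := hf.of_le (by norm_num)
  have hr1 : ContDiff ℝ 1 r := hr.of_le (by norm_num)
  rw [pd_mul hr1 hf1.exp, pd_comp hf1 i y (Real.hasDerivAt_exp (f y))]
  have e : exp (-f y) * exp (f y) = 1 := by rw [← Real.exp_add]; simp
  simp only [PiLp.add_apply, PiLp.smul_apply, smul_eq_mul, grad_apply]
  linear_combination (pd i r y + r y * pd i f y) * e

theorem ratio_eq (x : EuclideanSpace ℝ (Fin n)) : r x / exp (-f x) = r x * exp (f x) := by
  rw [Real.exp_neg, div_inv_eq_mul]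

theorem fisher_eq (hf : ContDiff ℝ 2 f) (hr : ContDiff ℝ 2 r) (hp : ∀ x, 0 < r x) (x) :
    r x * ‖gradient (fun y => log (r y / exp (-f y))) x‖ ^ 2 =
      exp (-f x) * ((r x * exp (f x))⁻¹ * ∑ i, pd i (fun y => r y * exp (f y)) x ^ 2) := by
  have hu : ContDiff ℝ 1 (fun y => r y * exp (f y)) := (hr.mul hf.exp).of_le (by norm_num)
  have hp' : 0 < r x * exp (f x) := mul_pos (hp x) (exp_pos _)
  rw [EuclideanSpace.norm_sq_eq]
  simp only [grad_apply, ratio_eq]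
  have h : ∀ i, pd i (fun y => log (r y * exp (f y))) x =
      (r x * exp (f x))⁻¹ * pd i (fun y => r y * exp (f y)) x := fun i =>
    pd_comp hu i x (Real.hasDerivAt_log hp'.ne')
  simp only [h, Real.norm_eq_abs, sq_abs, mul_pow, ← Finset.mul_sum]
  have e : exp (-f x) = (exp (f x))⁻¹ := Real.exp_neg _
  have h1 := (hp x).ne'
  have h2 := (exp_pos (f x)).ne'
  rw [e]
  field_simp

end
end FPE
theorem stmt6 {n : ℕ} (hn : 1 ≤ n) (α : ℝ) (hα : 0 < α)
    (f : EuclideanSpace ℝ (Fin n) → ℝ)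
    (hf : ContDiff ℝ 2 f)
    (hν : ∫ x, exp (-f x) = 1)
    (ρ : ℝ → EuclideanSpace ℝ (Fin n) → ℝ)
    (hρpos : ∀ t, 0 ≤ t → ∀ x, 0 < ρ t x)
    (hρprob : ∀ t, 0 ≤ t → ∫ x, ρ t x = 1)
    (hρx : ∀ t, 0 ≤ t → ContDiff ℝ 2 (ρ t))
    (hρt : ∀ x, ContDiff ℝ 1 (fun s => ρ s x))
    -- the Fokker–Planck equation ∂ρ/∂t = div (ρ ∇f + ∇ρ) for t ≥ 0:
    (hFP : ∀ t, 0 ≤ t → ∀ x, deriv (fun s => ρ s x) t =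
      vdiv (fun y => ρ t y • gradient f y + gradient (ρ t) y) x)
    -- (i) integrability:
    (hint1 : ∀ t, 0 ≤ t → Integrable (fun x => ρ t x * log (ρ t x / exp (-f x))))
    (hint2 : ∀ t, 0 ≤ t →
      Integrable (fun x => ρ t x * ‖gradient (fun y => log (ρ t y / exp (-f y))) x‖ ^ 2))
    -- (ii) differentiation under the integral sign:
    (hderiv : ∀ t, 0 ≤ t → HasDerivAt (fun s => ∫ x, ρ s x * log (ρ s x / exp (-f x)))
      (∫ x, deriv (fun s => ρ s x) t * log (ρ t x / exp (-f x))) t)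
    -- (iii) the total divergence (the boundary term) vanishes:
    (hbdry : ∀ t, 0 ≤ t → ∫ x, vdiv (fun y =>
        log (ρ t y / exp (-f y)) • (ρ t y • gradient f y + gradient (ρ t) y)) x = 0)
    -- (iv) the log-Sobolev inequality in Fisher-information form:
    (hLSI : ∀ t, 0 ≤ t →
      ∫ x, ρ t x * ‖gradient (fun y => log (ρ t y / exp (-f y))) x‖ ^ 2
        ≥ 2 * α * ∫ x, ρ t x * log (ρ t x / exp (-f x))) :
    ∀ t, 0 ≤ t → ∫ x, ρ t x * log (ρ t x / exp (-f x))
      ≤ exp (-2 * α * t) * ∫ x, ρ 0 x * log (ρ 0 x / exp (-f x)) := by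
  have hc : ∀ t x, ρ t x * exp (f x) * exp (-f x) = ρ t x := by
    intro t x
    rw [mul_assoc, ← Real.exp_add]; simp
  have hdiff : ∀ x t, HasDerivAt (fun s => ρ s x) (deriv (fun s => ρ s x) t) t := fun x t =>
    ((hρt x).differentiable (by norm_num) t).hasDerivAt
  let S : FPE.Sys n :=
    { ν := fun x => exp (-f x)
      u := fun t x => ρ t x * exp (f x)
      ud := fun t x => deriv (fun s => ρ s x) t * exp (f x)
      νC := (hf.of_le (by norm_num)).neg.exp
      νpos := fun x => exp_pos _
      νint := FPE.int_of_mass hν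
      νmass := hν
      uC := fun t ht => (hρx t ht).mul hf.exp
      upos := fun t ht x => mul_pos (hρpos t ht x) (exp_pos _)
      uint := fun t ht => by
        simp only [hc]; exact FPE.int_of_mass (hρprob t ht)
      umass := fun t ht => by
        simp only [hc]; exact hρprob t ht
      hud := fun x t => (hdiff x t).mul_const _
      udc := fun x => ((hρt x).continuous_deriv (by norm_num)).mul continuous_const
      pde := fun t ht x => by
        have e : deriv (fun s => ρ s x) t * exp (f x) * exp (-f x) = deriv (fun s => ρ s x) t := by
          rw [mul_assoc, ← Real.exp_add]; simp
        rw [e, hFP t ht x]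
        unfold vdiv FPE.Aop
        refine Finset.sum_congr rfl fun i _ => ?_
        simp only [FPE.flux_eq hf (hρx t ht)]
        rfl }
  have hE : ∀ t, (fun x => ρ t x * log (ρ t x / exp (-f x))) =
      fun x => S.u t x * log (S.u t x) * S.ν x := by
    intro t
    ext x
    change _ = ρ t x * exp (f x) * log (ρ t x * exp (f x)) * exp (-f x)
    rw [FPE.ratio_eq]
    linear_combination (- log (ρ t x * exp (f x))) * hc t x
  have hF : ∀ t, 0 ≤ t → (fun x => ρ t x * ‖gradient (fun y => log (ρ t y / exp (-f y))) x‖ ^ 2) =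
      fun x => S.ν x * ((S.u t x)⁻¹ * ∑ i, FPE.pd i (S.u t) x ^ 2) := by
    intro t ht
    ext x
    exact FPE.fisher_eq hf (hρx t ht) (hρpos t ht) x
  intro t ht
  have h := FPE.main (S := S) (fun t ht => (hF t ht) ▸ hint2 t ht) (fun t ht => (hE t) ▸ hint1 t ht)
    (show 0 < 2 * α by linarith) (fun t ht => by
      have := hLSI t ht
      rw [hE, hF t ht] at this
      exact this) ht
  rw [hE, hE]
  rw [show -2 * α * t = - (2 * α * t) by ring]
  exact h
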